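/- arXiv:2503.09741 — 3 statements merged into one kernel-verified Lean document; each statement's English description precedes it below -/
import Mathlib

section
/- For every γ ∈ Γ₁(q₁q₂), the number gcd(q₁,q₂)·S_{χ₁,χ₂}(γ) lies in ℤ[χ₁,χ₂]; that is, S_{χ₁,χ₂}(Γ₁(q₁q₂)) ⊆ (1/gcd(q₁,q₂))·ℤ[χ₁,χ₂]. -/
open Complex Finset
open scoped Classical

/-- The sawtooth function `B₁(x)`: `0` if `x ∈ ℤ`, and `x - ⌊x⌋ - 1/2` otherwise. -/
noncomputable def sawtooth (x : ℝ) : ℝ :=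
  if ∃ n : ℤ, (n : ℝ) = x then 0 else Int.fract x - 1 / 2

/-- The newform Dedekind sum `S_{χ₁,χ₂}(a, c)` associated to Dirichlet characters
`χ₁ mod q₁` and `χ₂ mod q₂`. -/
noncomputable def newformDedekindSum {q₁ q₂ : ℕ} (χ₁ : DirichletCharacter ℂ q₁)
    (χ₂ : DirichletCharacter ℂ q₂) (a c : ℤ) : ℂ :=
  ∑ j ∈ Finset.range c.toNat, ∑ n ∈ Finset.range q₁,
    (starRingEnd ℂ) (χ₂ (j : ZMod q₂)) * (starRingEnd ℂ) (χ₁ (n : ZMod q₁)) *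
      (sawtooth ((j : ℝ) / (c : ℝ)) : ℂ) *
      (sawtooth ((n : ℝ) / (q₁ : ℝ) + (a : ℝ) * (j : ℝ) / (c : ℝ)) : ℂ)

/-- The newform Dedekind sum of a matrix `γ = (a, b; c, d) ∈ SL₂(ℤ)`:
it is `S_{χ₁,χ₂}(a, c)` if `c ≥ 1`, `S_{χ₁,χ₂}(-γ)` if `c ≤ -1`, and `0` if `c = 0`. -/
noncomputable def newformDedekindSumSL {q₁ q₂ : ℕ} (χ₁ : DirichletCharacter ℂ q₁)
    (χ₂ : DirichletCharacter ℂ q₂) (γ : Matrix.SpecialLinearGroup (Fin 2) ℤ) : ℂ :=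
  if γ.1 1 0 = 0 then 0
  else if 1 ≤ γ.1 1 0 then newformDedekindSum χ₁ χ₂ (γ.1 0 0) (γ.1 1 0)
  else newformDedekindSum χ₁ χ₂ (-(γ.1 0 0)) (-(γ.1 1 0))

/-- Membership in `Γ₀(N)`: the lower-left entry is divisible by `N`. -/
def InGamma0 (N : ℕ) (γ : Matrix.SpecialLinearGroup (Fin 2) ℤ) : Prop :=
  (N : ℤ) ∣ γ.1 1 0

/-- Membership in `Γ₁(N)`: lower-left entry divisible by `N` and both diagonal
entries congruent to `1` mod `N`. -/
def InGamma1 (N : ℕ) (γ : Matrix.SpecialLinearGroup (Fin 2) ℤ) : Prop :=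
  InGamma0 N γ ∧ (N : ℤ) ∣ (γ.1 0 0 - 1) ∧ (N : ℤ) ∣ (γ.1 1 1 - 1)

/-- `x` lies in the ring of integers `ℤ[χ₁,χ₂]` of the field `F_{χ₁,χ₂} ⊆ ℂ` generated
by the values of `χ₁` and `χ₂`: `x` lies in the subfield of `ℂ` generated by the values
of the characters and is integral over `ℤ`. -/
def InRingOfIntegers {q₁ q₂ : ℕ} (χ₁ : DirichletCharacter ℂ q₁)
    (χ₂ : DirichletCharacter ℂ q₂) (x : ℂ) : Prop :=
  x ∈ Subfield.closure (Set.range (χ₁ : ZMod q₁ → ℂ) ∪ Set.range (χ₂ : ZMod q₂ → ℂ)) ∧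
    IsIntegral ℤ x

theorem sum_range_mul {M : Type*} [AddCommMonoid M] (f : ℕ → M) (q K : ℕ) :
    ∑ i ∈ range (q * K), f i = ∑ n ∈ range q, ∑ k ∈ range K, f (n + q * k) := by
  induction K with
  | zero => simp
  | succ K ih =>
    simp only [Nat.mul_succ, Finset.sum_range_add, ih, Finset.sum_range_succ,
      Finset.sum_add_distrib]
    simp only [add_comm]

theorem sum_range_eq_sum_reflect {h : ℤ → ℂ} (A : ℕ) (h0 : h 0 = 0) (hA : h A = 0) :
    ∑ i ∈ range A, h i = ∑ i ∈ range A, h (A - i) := by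
  have h1 := Finset.sum_range_reflect (fun i : ℕ ↦ h i) (A + 1)
  rw [Finset.sum_range_succ, Finset.sum_range_succ] at h1
  simp only [hA, add_tsub_cancel_right, tsub_self, Nat.cast_zero, h0, add_zero] at h1
  rw [← h1]
  refine Finset.sum_congr rfl fun i hi ↦ ?_
  rw [Nat.cast_sub (Finset.mem_range.mp hi).le]

theorem sum_range_add_of_periodic {h : ℤ → ℂ} {p : ℕ} (hh : Function.Periodic h p) (r : ℤ) :
    ∑ n ∈ range p, h (n + r) = ∑ n ∈ range p, h n := by
  have step : ∀ r : ℤ, ∑ n ∈ range p, h (n + (r + 1)) = ∑ n ∈ range p, h (n + r) := by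
    intro r
    have h1 := Finset.sum_range_succ (fun n : ℕ ↦ h (n + r)) p
    rw [Finset.sum_range_succ'] at h1
    have h2 : h (p + r) = h r := by rw [add_comm]; exact hh r
    simp only [h2, Nat.cast_zero, zero_add, add_left_inj] at h1
    rw [← h1]
    refine Finset.sum_congr rfl fun n _ ↦ ?_
    push_cast
    ring_nf
  induction r using Int.induction_on with
  | zero => simp
  | succ i ih => rw [step, ih]
  | pred i ih => rw [← ih, ← step]; simp

theorem sum_range_neg_of_periodic {h : ℤ → ℂ} {p : ℕ} (hh : Function.Periodic h p) :
    ∑ n ∈ range p, h (-n) = ∑ n ∈ range p, h n := by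
  rw [← Finset.sum_range_reflect, ← sum_range_add_of_periodic hh (1 - p)]
  refine Finset.sum_congr rfl fun n hn ↦ ?_
  rw [Nat.sub_sub, Nat.cast_sub (by have := Finset.mem_range.mp hn; omega)]
  push_cast
  ring_nf

theorem sum_ite_le_eq_floor_add_one {y : ℝ} {K : ℕ} (h0 : -1 < y) (h1 : y < K) :
    ∑ k ∈ range K, (if (k : ℝ) ≤ y then (1 : ℂ) else 0) = (⌊y⌋ : ℂ) + 1 := by
  have hf : -1 ≤ ⌊y⌋ := Int.le_floor.mpr (by push_cast; exact h0.le)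
  have hK : ⌊y⌋ < K := Int.floor_lt.mpr (by exact_mod_cast h1)
  rw [Finset.sum_boole]
  have : (range K).filter (fun k : ℕ ↦ (k : ℝ) ≤ y) = range (⌊y⌋ + 1).toNat := by
    ext k
    have : (k : ℝ) ≤ y ↔ (k : ℤ) ≤ ⌊y⌋ := by rw [Int.le_floor]; simp
    simp only [Finset.mem_filter, Finset.mem_range, this]
    omega
  rw [this, Finset.card_range]
  have h2 : (((⌊y⌋ + 1).toNat : ℤ) : ℂ) = ((⌊y⌋ + 1 : ℤ) : ℂ) := by
    rw [Int.toNat_of_nonneg (by omega)]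
  push_cast at h2
  exact h2

/-- Sums over an arithmetic progression of step `a` as sums over a residue class. -/
theorem sum_progression_of_periodic {h : ℤ → ℂ} {a q : ℕ} (ha : 0 < a)
    (hh : Function.Periodic h (a * q : ℕ)) (r : ℤ) :
    ∑ m ∈ range q, h (a * m + r) = ∑ j ∈ range (a * q), if (a : ℤ) ∣ j - r then h j else 0 := by
  have ha' : (0 : ℤ) < a := by exact_mod_cast ha
  have hper : Function.Periodic (fun m : ℤ ↦ h (a * m + r % a)) q := by
    intro m
    have := hh (a * m + r % a)
    simp only
    rw [← this]
    push_cast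
    ring_nf
  have h1 := sum_range_add_of_periodic hper (r / a)
  have h2 : ∀ m : ℕ, h (a * (m + r / a) + r % a) = h (a * m + r) := by
    intro m
    rw [mul_add, add_assoc, Int.mul_ediv_add_emod]
  simp only [h2] at h1
  rw [h1, sum_range_mul, Finset.sum_comm]
  refine Finset.sum_congr rfl fun m _ ↦ ?_
  have hr0 : 0 ≤ r % a := Int.emod_nonneg _ ha'.ne'
  have hr1 : r % a < a := Int.emod_lt_of_pos _ ha'
  rw [Finset.sum_eq_single (r % a).toNat]
  · rw [if_pos]
    · congr 1
      push_cast
      rw [Int.toNat_of_nonneg hr0]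
      ring
    · push_cast
      rw [Int.toNat_of_nonneg hr0]
      refine ⟨m - r / a, ?_⟩
      have := Int.mul_ediv_add_emod r a
      linarith
  · intro n hn hne
    rw [if_neg]
    intro hd
    apply hne
    have hn' := Finset.mem_range.mp hn
    have : (n : ℤ) = r % a := by
      obtain ⟨k, hk⟩ := hd
      have h3 : r % a = n % a :=
        Int.modEq_iff_dvd.mpr ⟨k - m, by push_cast at hk; linear_combination hk⟩
      rw [h3, Int.emod_eq_of_lt (by positivity) (by exact_mod_cast hn')]
    omega
  · intro hn
    exact absurd (Finset.mem_range.mpr (by omega)) hn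

/-- Periodic functions on `ℤ` with a parity, vanishing at `0` and summing to `0` along every
progression of length `q` with step prime to `q`, such as nontrivial Dirichlet characters. -/
structure IsBalanced (X : ℤ → ℂ) (q : ℕ) (δ : ℂ) : Prop where
  periodic : Function.Periodic X q
  sum_progression : ∀ a : ℕ, a.Coprime q → ∀ i : ℤ, ∑ s ∈ range q, X (i + a * s) = 0
  neg : ∀ n, X (-n) = δ * X n
  zero : X 0 = 0

namespace IsBalanced

variable {X Y : ℤ → ℂ} {q q₁ q₂ : ℕ} {δ : ℂ}

theorem sum_eq_zero (hX : IsBalanced X q δ) : ∑ n ∈ range q, X n = 0 := by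
  simpa using hX.sum_progression 1 (Nat.coprime_one_left q) 0

theorem add_mul (hX : IsBalanced X q δ) (n k : ℤ) : X (n + q * k) = X n := by
  rw [mul_comm]
  exact hX.periodic.int_mul k n

theorem eq_zero_of_dvd (hX : IsBalanced X q δ) {n : ℤ} (h : (q : ℤ) ∣ n) : X n = 0 := by
  obtain ⟨k, rfl⟩ := h
  simpa [hX.zero] using hX.add_mul 0 k

theorem sum_range_mul_eq_zero (hX : IsBalanced X q δ) (K : ℕ) :
    ∑ i ∈ range (q * K), X i = 0 := by
  rw [sum_range_mul, Finset.sum_comm]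
  refine Finset.sum_eq_zero fun k _ ↦ ?_
  push_cast
  simp only [hX.add_mul, hX.sum_eq_zero]

/-- The first moment over `q * K` consecutive integers does not depend on `K`. -/
theorem moment_range_mul (hX : IsBalanced X q δ) (hq : 0 < q) {K : ℕ} (hK : 0 < K) :
    ∑ i ∈ range (q * K), X i * ((i : ℂ) / (q * K : ℕ)) =
      ∑ n ∈ range q, X n * ((n : ℂ) / q) := by
  have hq' : (q : ℂ) ≠ 0 := by exact_mod_cast hq.ne'
  have hK' : (K : ℂ) ≠ 0 := by exact_mod_cast hK.ne'
  have h : ∀ n k : ℕ, X (n + q * k : ℕ) * (((n + q * k : ℕ) : ℂ) / (q * K : ℕ)) =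
      X n * ((n : ℂ) / q) * (1 / K) + X n * (k / K) := by
    intro n k
    push_cast
    rw [hX.add_mul]
    field_simp
  rw [sum_range_mul]
  simp only [h, Finset.sum_add_distrib, ← Finset.mul_sum, ← Finset.sum_mul, hX.sum_eq_zero]
  simp [hK']

theorem moment_parity (hX : IsBalanced X q δ) (hq : 0 < q) :
    δ * ∑ n ∈ range q, X n * ((n : ℂ) / q) = -∑ n ∈ range q, X n * ((n : ℂ) / q) := by
  have hq' : (q : ℂ) ≠ 0 := by exact_mod_cast hq.ne'
  have h := sum_range_eq_sum_reflect (h := fun n ↦ X n * ((n : ℂ) / q)) q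
    (by simp) (by simp [hX.eq_zero_of_dvd dvd_rfl])
  have h2 : ∀ n : ℕ, X ((q : ℤ) - n) * ((((q : ℤ) - n : ℤ) : ℂ) / q) =
      δ * X n - δ * (X n * ((n : ℂ) / q)) := by
    intro n
    have : X ((q : ℤ) - n) = δ * X n := by
      rw [← hX.neg, sub_eq_neg_add]; exact hX.periodic _
    rw [this]
    push_cast
    field_simp
  simp only [h2, Finset.sum_sub_distrib, ← Finset.mul_sum, hX.sum_eq_zero, Int.cast_natCast] at h
  linear_combination h

theorem sum_mul_floor (hX : IsBalanced X q δ) (hq : 0 < q) {y : ℝ} {K : ℕ} (h0 : 0 ≤ y)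
    (h1 : y < K) :
    ∑ n ∈ range q, X n * (⌊y - n / q⌋ : ℂ) =
      ∑ i ∈ range (q * K), if (i : ℝ) ≤ q * y then X i else 0 := by
  have hq' : (0 : ℝ) < q := by exact_mod_cast hq
  rw [← add_zero (∑ n ∈ range q, X n * (⌊y - n / q⌋ : ℂ)), sum_range_mul]
  conv_lhs => rw [← hX.sum_eq_zero, ← Finset.sum_add_distrib]
  refine Finset.sum_congr rfl fun n hn ↦ ?_
  have hn' : (n : ℝ) < q := by exact_mod_cast Finset.mem_range.mp hn
  have hnq : (n : ℝ) / q < 1 := (div_lt_one hq').mpr hn'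
  have hnq0 : 0 ≤ (n : ℝ) / q := by positivity
  rw [← mul_add_one, ← sum_ite_le_eq_floor_add_one (y := y - n / q) (K := K) (by linarith) (by linarith),
    Finset.mul_sum]
  refine Finset.sum_congr rfl fun k _ ↦ ?_
  have : (k : ℝ) ≤ y - n / q ↔ ((n + q * k : ℕ) : ℝ) ≤ q * y := by
    rw [le_sub_iff_add_le, ← mul_le_mul_iff_right₀ hq']
    push_cast
    rw [mul_add, mul_div_cancel₀ _ hq'.ne', add_comm]
  simp only [this]
  push_cast
  rw [hX.add_mul]
  split_ifs <;> simp

end IsBalanced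

theorem sawtooth_add_int (x : ℝ) (k : ℤ) : sawtooth (x + k) = sawtooth x := by
  have : (∃ n : ℤ, (n : ℝ) = x + k) ↔ ∃ n : ℤ, (n : ℝ) = x :=
    ⟨fun ⟨n, hn⟩ ↦ ⟨n - k, by push_cast; linarith⟩, fun ⟨n, hn⟩ ↦ ⟨n + k, by push_cast; linarith⟩⟩
  simp only [sawtooth, this, Int.fract_add_intCast]

theorem sawtooth_of_ne_int {x : ℝ} (h : ∀ k : ℤ, (k : ℝ) ≠ x) :
    sawtooth x = x - ⌊x⌋ - 1 / 2 := by
  rw [sawtooth, if_neg (by simpa using h), Int.fract]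

/-- The sum of `X i * Y m * B₁(i / A) * B₁(m / q + C i / (q A))` over `i < A` and `m < q`. -/
noncomputable def twistedSawSum (X Y : ℤ → ℂ) (q A C : ℕ) : ℂ :=
  ∑ i ∈ range A, ∑ m ∈ range q, X i * Y m * (sawtooth ((i : ℝ) / A) : ℂ) *
    (sawtooth ((m : ℝ) / q + C * i / (q * A)) : ℂ)

/-- No point `(i, j)` of the support of `X i * Y j` lies on the line `i C = j A`. -/
def DiagonalFree (X Y : ℤ → ℂ) (A C : ℕ) : Prop :=
  ∀ i j : ℤ, i * C = j * A → X i * Y j = 0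

namespace IsBalanced

variable {X Y : ℤ → ℂ} {q q₁ q₂ : ℕ} {δ : ℂ}

theorem sum_mul_sawtooth (hY : IsBalanced Y q δ) (hq : 0 < q) {A M i : ℕ} (hM : 0 < M)
    (hi : i < A) (hd : ∀ j : ℤ, (i : ℤ) * (q * M : ℕ) = j * A → Y j = 0) :
    ∑ m ∈ range q, Y m * (sawtooth ((m : ℝ) / q + (q * M : ℕ) * i / (q * A)) : ℂ) =
      ∑ n ∈ range q, Y n * ((n : ℂ) / q) -
        δ * ∑ j ∈ range (q * M), if j * A ≤ i * (q * M) then Y j else 0 := by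
  have hA : 0 < A := by omega
  have hq' : (q : ℝ) ≠ 0 := by exact_mod_cast hq.ne'
  have hA' : (0 : ℝ) < A := by exact_mod_cast hA
  have hM' : (0 : ℝ) < M := by exact_mod_cast hM
  set x : ℝ := M * i / A with hx
  have hx' : ((q * M : ℕ) : ℝ) * i / (q * A) = x := by
    rw [hx]; push_cast; field_simp
  have hper : Function.Periodic (fun m : ℤ ↦ Y m * (sawtooth ((m : ℝ) / q + x) : ℂ)) q := by
    intro m
    have : ((m + q : ℤ) : ℝ) / q + x = m / q + x + (1 : ℤ) := by
      push_cast; field_simp; ring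
    simp only [this, sawtooth_add_int, hY.periodic m]
  have h1 := sum_range_neg_of_periodic hper
  simp only [Int.cast_natCast] at h1
  rw [hx', ← h1]
  have h2 : ∀ m : ℕ, Y (-m) * (sawtooth (((-m : ℤ) : ℝ) / q + x) : ℂ) =
      δ * (Y m * ((x : ℂ) - 1 / 2) - Y m * ((m : ℂ) / q) - Y m * (⌊x - m / q⌋ : ℂ)) := by
    intro m
    rw [hY.neg]
    by_cases hm : Y m = 0
    · simp [hm]
    have hne : ∀ k : ℤ, (k : ℝ) ≠ x - m / q := by
      intro k hk
      apply hm
      rw [← hY.add_mul m k]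
      apply hd
      rw [hx] at hk
      field_simp at hk
      have : (((i : ℤ) * (q * M : ℕ) : ℤ) : ℝ) = (((m + q * k) * A : ℤ) : ℝ) := by
        push_cast; linear_combination -hk
      exact_mod_cast this
    have h3 : (((-m : ℤ) : ℝ) / q + x) = x - m / q := by push_cast; ring
    rw [h3, sawtooth_of_ne_int hne]
    push_cast
    ring
  have hx0 : 0 ≤ x := by positivity
  have hxM : x < M := by
    rw [hx, div_lt_iff₀ hA']
    exact mul_lt_mul_of_pos_left (by exact_mod_cast hi) hM'
  simp only [h2, ← Finset.mul_sum, Finset.sum_sub_distrib, ← Finset.sum_mul, hY.sum_eq_zero]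
  rw [hY.sum_mul_floor hq hx0 hxM]
  have h4 : ∀ j : ℕ, (j : ℝ) ≤ q * x ↔ j * A ≤ i * (q * M) := by
    intro j
    rw [hx, ← mul_div_assoc, le_div_iff₀ hA', ← Nat.cast_le (α := ℝ)]
    push_cast
    rw [show (q : ℝ) * (M * i) = i * (q * M) by ring]
  simp only [h4]
  linear_combination -hY.moment_parity hq

theorem sum_lattice_le_eq_zero (hX : IsBalanced X q₁ δ) (hY : IsBalanced Y q₂ δ) (hδ : δ * δ = 1)
    (K M : ℕ) (hd : DiagonalFree X Y (q₁ * K) (q₂ * M)) :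
    ∑ i ∈ range (q₁ * K), ∑ j ∈ range (q₂ * M),
      (if j * (q₁ * K) ≤ i * (q₂ * M) then X i * Y j else 0) = 0 := by
  set A := q₁ * K
  set C := q₂ * M
  have hXA : ∀ i : ℤ, X (A - i) = δ * X i := by
    intro i
    rw [← hX.neg, ← hX.add_mul (-i) K]; simp only [A]; push_cast; ring_nf
  have hYC : ∀ j : ℤ, Y (C - j) = δ * Y j := by
    intro j
    rw [← hY.neg, ← hY.add_mul (-j) M]; simp only [C]; push_cast; ring_nf
  have hXA0 : X A = 0 := by simpa [hX.zero] using hXA 0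
  have hYC0 : Y C = 0 := by simpa [hY.zero] using hYC 0
  have h1 : ∑ i ∈ range A, ∑ j ∈ range C, (if (j : ℤ) * A ≤ i * C then X i * Y j else 0) =
      ∑ i ∈ range A, ∑ j ∈ range C, (if (i : ℤ) * C ≤ j * A then X i * Y j else 0) := by
    rw [sum_range_eq_sum_reflect
      (h := fun i : ℤ ↦ ∑ j ∈ range C, (if (j : ℤ) * A ≤ i * C then X i * Y j else 0)) A
      (by simp [hX.zero]) (by simp [hXA0])]
    refine Finset.sum_congr rfl fun i _ ↦ ?_
    rw [sum_range_eq_sum_reflect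
      (h := fun j : ℤ ↦ (if (j : ℤ) * A ≤ (A - i : ℤ) * C then X (A - i : ℤ) * Y j else 0)) C
      (by simp [hY.zero]) (by simp [hYC0])]
    refine Finset.sum_congr rfl fun j _ ↦ ?_
    have : ((C : ℤ) - j) * A ≤ (A - i) * C ↔ (i : ℤ) * C ≤ j * A := by
      constructor <;> intro h <;> linarith
    simp only [this, hXA, hYC]
    split_ifs
    · linear_combination (X i * Y j) * hδ
    · rfl
  have h2 : ∑ i ∈ range A, ∑ j ∈ range C, (if (j : ℤ) * A ≤ i * C then X i * Y j else 0) +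
      ∑ i ∈ range A, ∑ j ∈ range C, (if (i : ℤ) * C ≤ j * A then X i * Y j else 0) = 0 := by
    have h3 : ∑ i ∈ range A, ∑ j ∈ range C, X i * Y j = 0 := by
      rw [← Finset.sum_mul_sum, hX.sum_range_mul_eq_zero, zero_mul]
    refine Eq.trans ?_ h3
    simp only [← Finset.sum_add_distrib]
    refine Finset.sum_congr rfl fun i _ ↦ Finset.sum_congr rfl fun j _ ↦ ?_
    rcases lt_trichotomy ((i : ℤ) * C) (j * A) with h | h | h
    · rw [if_neg (by omega), if_pos h.le, zero_add]
    · simp [hd i j h]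
    · rw [if_pos h.le, if_neg (by omega), add_zero]
  rw [← h1] at h2
  have h4 : ∑ i ∈ range A, ∑ j ∈ range C, (if j * A ≤ i * C then X i * Y j else 0) =
      ∑ i ∈ range A, ∑ j ∈ range C, (if (j : ℤ) * A ≤ i * C then X i * Y j else 0) := by
    refine Finset.sum_congr rfl fun i _ ↦ Finset.sum_congr rfl fun j _ ↦ ?_
    norm_cast
  rw [h4]
  exact add_self_eq_zero.mp h2

/-- The twisted sum as a product of first moments plus a sum over the lattice points of a
rectangle below its diagonal. -/
theorem twistedSawSum_eq (hX : IsBalanced X q₁ δ) (hY : IsBalanced Y q₂ δ) (hδ : δ * δ = 1)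
    (hq₁ : 0 < q₁) (hq₂ : 0 < q₂) {K M : ℕ} (hK : 0 < K) (hM : 0 < M)
    (hd : DiagonalFree X Y (q₁ * K) (q₂ * M)) :
    twistedSawSum X Y q₂ (q₁ * K) (q₂ * M) =
      (∑ n ∈ range q₁, X n * ((n : ℂ) / q₁)) * (∑ n ∈ range q₂, Y n * ((n : ℂ) / q₂)) -
      δ * ∑ i ∈ range (q₁ * K), ∑ j ∈ range (q₂ * M),
        (if j * (q₁ * K) ≤ i * (q₂ * M) then X i * Y j else 0) * ((i : ℂ) / (q₁ * K : ℕ)) := by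
  set βY := ∑ n ∈ range q₂, Y n * ((n : ℂ) / q₂) with hβY
  have hA : 0 < q₁ * K := Nat.mul_pos hq₁ hK
  have key : ∀ i ∈ range (q₁ * K), (∑ m ∈ range q₂, X i * Y m *
      (sawtooth ((i : ℝ) / (q₁ * K : ℕ)) : ℂ) *
      (sawtooth ((m : ℝ) / q₂ + (q₂ * M : ℕ) * i / (q₂ * (q₁ * K : ℕ))) : ℂ)) =
      X i * ((i : ℂ) / (q₁ * K : ℕ)) * βY - X i * (1 / 2 * βY) -
      δ * (∑ j ∈ range (q₂ * M),
        (if j * (q₁ * K) ≤ i * (q₂ * M) then X i * Y j else 0) * ((i : ℂ) / (q₁ * K : ℕ))) +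
      δ / 2 * (∑ j ∈ range (q₂ * M),
        (if j * (q₁ * K) ≤ i * (q₂ * M) then X i * Y j else 0)) := by
    intro i hi
    have hi' := Finset.mem_range.mp hi
    by_cases hXi : X i = 0
    · simp [hXi]
    have hi0 : 0 < i := Nat.pos_of_ne_zero fun h ↦ hXi (by simp [h, hX.zero])
    have hsaw : sawtooth ((i : ℝ) / (q₁ * K : ℕ)) = (i : ℝ) / (q₁ * K : ℕ) - 1 / 2 := by
      have hA' : (0 : ℝ) < (q₁ * K : ℕ) := by exact_mod_cast hA
      have hlt : (i : ℝ) / (q₁ * K : ℕ) < 1 := by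
        rw [div_lt_one hA']; exact_mod_cast hi'
      have hpos : 0 < (i : ℝ) / (q₁ * K : ℕ) := div_pos (by exact_mod_cast hi0) hA'
      rw [sawtooth_of_ne_int, Int.floor_eq_zero_iff.mpr ⟨hpos.le, hlt⟩]
      · simp
      · intro k hk
        rw [← hk] at hlt hpos
        have h1 : k < 1 := by exact_mod_cast hlt
        have h2 : 0 < k := by exact_mod_cast hpos
        omega
    have h1 := hY.sum_mul_sawtooth hq₂ hM hi'
      (fun j hj ↦ (mul_eq_zero.mp (hd i j hj)).resolve_left hXi)
    have h2 : ∑ j ∈ range (q₂ * M), (if j * (q₁ * K) ≤ i * (q₂ * M) then X i * Y j else 0) =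
        X i * ∑ j ∈ range (q₂ * M), (if j * (q₁ * K) ≤ i * (q₂ * M) then Y j else 0) := by
      rw [Finset.mul_sum]
      refine Finset.sum_congr rfl fun j _ ↦ ?_
      split_ifs <;> simp
    rw [← Finset.sum_mul, h2]
    simp only [mul_assoc, mul_left_comm _ (sawtooth ((i : ℝ) / (q₁ * K : ℕ)) : ℂ)]
    rw [← Finset.mul_sum, ← Finset.mul_sum, h1, hsaw]
    push_cast
    ring
  rw [twistedSawSum, Finset.sum_congr rfl key, Finset.sum_add_distrib, Finset.sum_sub_distrib,
    Finset.sum_sub_distrib, ← Finset.sum_mul, ← Finset.sum_mul, ← Finset.mul_sum,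
    ← Finset.mul_sum, hX.sum_lattice_le_eq_zero hY hδ K M hd, hX.sum_range_mul_eq_zero,
    hX.moment_range_mul hq₁ hK]
  ring

end IsBalanced

namespace DiagonalFree

variable {X Y : ℤ → ℂ} {A C q₁ q₂ : ℕ} {δ : ℂ}

theorem symm (h : DiagonalFree X Y A C) : DiagonalFree Y X C A :=
  fun i j hij ↦ by rw [mul_comm]; exact h j i hij.symm

theorem of_coprime (hY : IsBalanced Y q₂ δ) (hq₁ : 0 < q₁) {a : ℕ} (ha : a.Coprime q₂) (c : ℕ) :
    DiagonalFree X Y (q₁ * a) (q₂ * (q₁ * c)) := by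
  intro i j hij
  have h1 : (q₁ : ℤ) * (a * j) = q₁ * (q₂ * (c * i)) := by push_cast at hij; linarith
  have h2 := mul_left_cancel₀ (by exact_mod_cast hq₁.ne') h1
  have h3 : (q₂ : ℤ) ∣ j :=
    (Nat.isCoprime_iff_coprime.mpr ha).symm.dvd_of_dvd_mul_left (Dvd.intro _ h2.symm)
  rw [hY.eq_zero_of_dvd h3, mul_zero]

end DiagonalFree

namespace IsBalanced

variable {X Y : ℤ → ℂ} {q q₁ q₂ : ℕ} {δ : ℂ}

theorem sum_mul_periodic_diff_eq_zero (hX : IsBalanced X q₁ δ) (hY : IsBalanced Y q₂ δ)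
    (hq₁ : 0 < q₁) (hq₂ : 0 < q₂) {a c : ℕ} (ha : 0 < a) (hc : 0 < c) (haq : a.Coprime q₁)
    {F : ℝ → ℂ} (hF : ∀ (x : ℝ) (k : ℤ), F (x + k) = F x) :
    ∑ i ∈ range (q₁ * a), ∑ j ∈ range (q₂ * (q₁ * c)),
      X i * Y j * F ((i : ℝ) / (q₁ * a : ℕ) - (j : ℝ) / (q₂ * (q₁ * c) : ℕ)) = 0 := by
  set A := q₁ * a with hA
  set C := q₂ * (q₁ * c) with hC
  have hq₁' : (q₁ : ℝ) ≠ 0 := by exact_mod_cast hq₁.ne'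
  have hq₂' : (q₂ : ℝ) ≠ 0 := by exact_mod_cast hq₂.ne'
  have ha' : (a : ℝ) ≠ 0 := by exact_mod_cast ha.ne'
  have hc' : (c : ℝ) ≠ 0 := by exact_mod_cast hc.ne'
  have hA' : (A : ℝ) ≠ 0 := by rw [hA]; push_cast; positivity
  have hC' : (C : ℝ) ≠ 0 := by rw [hC]; push_cast; positivity
  let H : ℤ → ℤ → ℂ := fun i j ↦ X i * Y j * F ((i : ℝ) / A - (j : ℝ) / C)
  have hH1 : ∀ j : ℤ, Function.Periodic (fun i ↦ H i j) A := by
    intro j i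
    have h1 : ((i + A : ℤ) : ℝ) / A - (j : ℝ) / C = i / A - j / C + (1 : ℤ) := by
      push_cast; field_simp; ring
    have h2 : X (i + A) = X i := by rw [hA]; push_cast; exact hX.add_mul i a
    simp only [H, h1, hF, h2]
  have hH2 : ∀ i : ℤ, Function.Periodic (fun j ↦ H i j) C := by
    intro i j
    have h1 : (i : ℝ) / A - ((j + C : ℤ) : ℝ) / C = i / A - j / C + (-1 : ℤ) := by
      push_cast; field_simp; ring
    have h2 : Y (j + C) = Y j := by
      rw [hC, Nat.cast_mul]; exact hY.add_mul j (q₁ * c : ℕ)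
    simp only [H, h1, hF, h2]
  have hshift : ∀ s : ℕ, ∑ i ∈ range A, ∑ j ∈ range C, H i j =
      ∑ i ∈ range A, ∑ j ∈ range C, X (i + a * s) * (Y j * F ((i : ℝ) / A - (j : ℝ) / C)) := by
    intro s
    have h1 : ∑ i ∈ range A, ∑ j ∈ range C, H i j =
        ∑ i ∈ range A, ∑ j ∈ range C, H (i + (a * s : ℤ)) (j + (q₂ * c * s : ℤ)) := by
      have h2 : ∀ i : ℤ, ∑ j ∈ range C, H i (j + (q₂ * c * s : ℤ)) = ∑ j ∈ range C, H i j :=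
        fun i ↦ sum_range_add_of_periodic (hH2 i) _
      simp only [h2]
      rw [Finset.sum_comm, Finset.sum_comm (s := range A)]
      exact Finset.sum_congr rfl fun j _ ↦ (sum_range_add_of_periodic (hH1 j) _).symm
    rw [h1]
    refine Finset.sum_congr rfl fun i _ ↦ Finset.sum_congr rfl fun j _ ↦ ?_
    have h3 : ((i + (a * s : ℤ) : ℤ) : ℝ) / A - ((j + (q₂ * c * s : ℤ) : ℤ) : ℝ) / C =
        i / A - j / C := by
      rw [hA, hC]; push_cast; field_simp; ring
    have h4 : Y (j + (q₂ * c * s : ℤ)) = Y j := by rw [mul_assoc]; exact hY.add_mul _ _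
    dsimp only [H]
    rw [h3, h4, mul_assoc]
  have h1 : ∑ s ∈ range q₁, ∑ i ∈ range A, ∑ j ∈ range C, H i j = 0 := by
    rw [Finset.sum_congr rfl fun s _ ↦ hshift s, Finset.sum_comm]
    refine Finset.sum_eq_zero fun i _ ↦ ?_
    rw [Finset.sum_comm]
    refine Finset.sum_eq_zero fun j _ ↦ ?_
    rw [← Finset.sum_mul, hX.sum_progression a haq, zero_mul]
  rw [Finset.sum_const, Finset.card_range, nsmul_eq_mul] at h1
  exact (mul_eq_zero.mp h1).resolve_left (by exact_mod_cast hq₁.ne')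

theorem sum_mul_abs_diff (hX : IsBalanced X q₁ δ) (hY : IsBalanced Y q₂ δ)
    (hq₁ : 0 < q₁) (hq₂ : 0 < q₂) {a c : ℕ} (ha : 0 < a) (hc : 0 < c) (haq : a.Coprime q₁) :
    ∑ i ∈ range (q₁ * a), ∑ j ∈ range (q₂ * (q₁ * c)),
      X i * Y j * (|(i : ℝ) / (q₁ * a : ℕ) - (j : ℝ) / (q₂ * (q₁ * c) : ℕ)| : ℝ) =
      -2 * (∑ n ∈ range q₁, X n * ((n : ℂ) / q₁)) * (∑ n ∈ range q₂, Y n * ((n : ℂ) / q₂)) := by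
  have h0 := hX.sum_mul_periodic_diff_eq_zero hY hq₁ hq₂ ha hc haq
    (F := fun x ↦ ((Int.fract x ^ 2 - Int.fract x : ℝ) : ℂ)) (by simp)
  have hM : 0 < q₁ * c := Nat.mul_pos hq₁ hc
  rw [← hX.moment_range_mul hq₁ ha, ← hY.moment_range_mul hq₂ hM]
  have hX0 := hX.sum_range_mul_eq_zero a
  have hY0 := hY.sum_range_mul_eq_zero (q₁ * c)
  have hA : 0 < q₁ * a := Nat.mul_pos hq₁ ha
  have hC : 0 < q₂ * (q₁ * c) := Nat.mul_pos hq₂ hM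
  set A := q₁ * a
  set C := q₂ * (q₁ * c)
  have hfr : ∀ x : ℝ, -1 < x → x < 1 → Int.fract x ^ 2 - Int.fract x = x ^ 2 - |x| := by
    intro x h1 h2
    rcases le_or_gt 0 x with h | h
    · rw [Int.fract_eq_self.mpr ⟨h, h2⟩, abs_of_nonneg h]
    · have : Int.fract x = x + 1 := by
        rw [← Int.fract_add_one, Int.fract_eq_self.mpr ⟨by linarith, by linarith⟩]
      rw [this, abs_of_neg h]; ring
  have key : ∀ i ∈ range A, ∀ j ∈ range C,
      X i * Y j * (|(i : ℝ) / A - (j : ℝ) / C| : ℝ) =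
      X i * ((i : ℂ) / A) ^ 2 * Y j + X i * (Y j * ((j : ℂ) / C) ^ 2) -
      2 * ((X i * ((i : ℂ) / A)) * (Y j * ((j : ℂ) / C))) -
      X i * Y j * ((Int.fract ((i : ℝ) / A - (j : ℝ) / C) ^ 2 -
        Int.fract ((i : ℝ) / A - (j : ℝ) / C) : ℝ) : ℂ) := by
    intro i hi j hj
    have hA' : (0 : ℝ) < A := by exact_mod_cast hA
    have hC' : (0 : ℝ) < C := by exact_mod_cast hC
    have h1 : (i : ℝ) / A < 1 := (div_lt_one hA').mpr (by exact_mod_cast Finset.mem_range.mp hi)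
    have h2 : (j : ℝ) / C < 1 := (div_lt_one hC').mpr (by exact_mod_cast Finset.mem_range.mp hj)
    have h3 : 0 ≤ (i : ℝ) / A := by positivity
    have h4 : 0 ≤ (j : ℝ) / C := by positivity
    rw [hfr _ (by linarith) (by linarith)]
    push_cast
    ring
  rw [Finset.sum_congr rfl fun i hi ↦ Finset.sum_congr rfl (key i hi)]
  simp only [Finset.sum_add_distrib, Finset.sum_sub_distrib]
  rw [h0]
  simp only [← Finset.mul_sum, ← Finset.sum_mul, hX0, hY0]
  ring

theorem twistedSawSum_reciprocity (hX : IsBalanced X q₁ δ) (hY : IsBalanced Y q₂ δ)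
    (hδ : δ * δ = 1) (hq₁ : 0 < q₁) (hq₂ : 0 < q₂) {a c : ℕ} (ha : 0 < a) (hc : 0 < c)
    (haq₁ : a.Coprime q₁) (haq₂ : a.Coprime q₂) :
    twistedSawSum X Y q₂ (q₁ * a) (q₂ * (q₁ * c)) +
      twistedSawSum Y X q₁ (q₂ * (q₁ * c)) (q₁ * a) =
      (∑ n ∈ range q₁, X n * ((n : ℂ) / q₁)) * (∑ n ∈ range q₂, Y n * ((n : ℂ) / q₂)) := by
  have hd : DiagonalFree X Y (q₁ * a) (q₂ * (q₁ * c)) := .of_coprime hY hq₁ haq₂ c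
  have hM : 0 < q₁ * c := Nat.mul_pos hq₁ hc
  have habs := hX.sum_mul_abs_diff hY hq₁ hq₂ ha hc haq₁
  have hpar := hX.moment_parity hq₁
  rw [hX.twistedSawSum_eq hY hδ hq₁ hq₂ ha hM hd, hY.twistedSawSum_eq hX hδ hq₂ hq₁ hM ha hd.symm]
  rw [Finset.sum_comm (s := range (q₂ * (q₁ * c)))]
  have hx0 := hX.moment_range_mul hq₁ ha
  have hy0 := hY.moment_range_mul hq₂ hM
  have hX0 := hX.sum_range_mul_eq_zero a
  have hY0 := hY.sum_range_mul_eq_zero (q₁ * c)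
  have hA : 0 < q₁ * a := Nat.mul_pos hq₁ ha
  have hC : 0 < q₂ * (q₁ * c) := Nat.mul_pos hq₂ hM
  set A := q₁ * a
  set C := q₂ * (q₁ * c)
  have hA' : (0 : ℝ) < A := by exact_mod_cast hA
  have hC' : (0 : ℝ) < C := by exact_mod_cast hC
  have key : ∑ i ∈ range A, ∑ j ∈ range C, (if j * A ≤ i * C then X i * Y j else 0) * ((i : ℂ) / A) +
      ∑ i ∈ range A, ∑ j ∈ range C, (if i * C ≤ j * A then Y j * X i else 0) * ((j : ℂ) / C) =
      ∑ i ∈ range A, ∑ j ∈ range C, (X i * ((i : ℂ) / A) * Y j + X i * (Y j * ((j : ℂ) / C)) +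
        X i * Y j * (|(i : ℝ) / A - (j : ℝ) / C| : ℝ)) * (1 / 2) := by
    simp only [← Finset.sum_add_distrib]
    refine Finset.sum_congr rfl fun i _ ↦ Finset.sum_congr rfl fun j _ ↦ ?_
    rcases lt_trichotomy (i * C) (j * A) with h | h | h
    · have h1 : (i : ℝ) / A - (j : ℝ) / C ≤ 0 := by
        rw [sub_nonpos, div_le_div_iff₀ hA' hC']; exact_mod_cast h.le
      rw [if_neg (by omega), if_pos h.le, abs_of_nonpos h1]
      push_cast
      ring
    · have h0 : X i * Y j = 0 := hd i j (by exact_mod_cast h)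
      rw [if_pos h.ge, if_pos h.le]
      linear_combination ((i : ℂ) / A / 2 + (j : ℂ) / C / 2 -
        (|(i : ℝ) / A - (j : ℝ) / C| : ℝ) * (1 / 2)) * h0
    · have h1 : 0 ≤ (i : ℝ) / A - (j : ℝ) / C := by
        rw [sub_nonneg, div_le_div_iff₀ hC' hA']; exact_mod_cast h.le
      rw [if_pos h.le, if_neg (by omega), abs_of_nonneg h1]
      push_cast
      ring
  simp only [← Finset.sum_mul, Finset.sum_add_distrib, habs] at key
  simp only [← Finset.mul_sum, ← Finset.sum_mul, hX0, hY0] at key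
  simp only [← Finset.sum_mul]
  linear_combination (-δ) * key +
    (∑ n ∈ range q₂, Y n * ((n : ℂ) / q₂)) * hpar

theorem mul_twistedSawSum (hY : IsBalanced Y q₂ δ) (hYm : ∀ m n, Y (m * n) = Y m * Y n)
    (hq₁ : 0 < q₁) (hq₂ : 0 < q₂) {a : ℕ} (ha : 0 < a) (c : ℕ) :
    Y a * twistedSawSum X Y q₂ (q₁ * a) (q₂ * (q₁ * c)) =
      ∑ i ∈ range (q₁ * a), ∑ j ∈ range (q₂ * a), if (a : ℤ) ∣ j - q₂ * c * i then
        X i * Y j * (sawtooth ((i : ℝ) / (q₁ * a : ℕ)) : ℂ) *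
          (sawtooth ((j : ℝ) / (q₂ * a : ℕ)) : ℂ) else 0 := by
  have hq₁' : (q₁ : ℝ) ≠ 0 := by exact_mod_cast hq₁.ne'
  have hq₂' : (q₂ : ℝ) ≠ 0 := by exact_mod_cast hq₂.ne'
  have ha' : (a : ℝ) ≠ 0 := by exact_mod_cast ha.ne'
  rw [twistedSawSum, Finset.mul_sum]
  refine Finset.sum_congr rfl fun i _ ↦ ?_
  have hper : Function.Periodic (fun j : ℤ ↦ X i * Y j *
      (sawtooth ((i : ℝ) / (q₁ * a : ℕ)) : ℂ) * (sawtooth ((j : ℝ) / (q₂ * a : ℕ)) : ℂ))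
      (a * q₂ : ℕ) := by
    intro j
    have h1 : ((j + (a * q₂ : ℕ) : ℤ) : ℝ) / (q₂ * a : ℕ) = j / (q₂ * a : ℕ) + (1 : ℤ) := by
      push_cast; field_simp
    have h2 : Y (j + (a * q₂ : ℕ)) = Y j := by
      rw [mul_comm a, Nat.cast_mul]; exact hY.add_mul j a
    simp only [h1, h2, sawtooth_add_int]
  have h := sum_progression_of_periodic ha hper (q₂ * c * i)
  simp only [mul_comm a q₂, Int.cast_natCast] at h
  rw [← h, Finset.mul_sum]
  refine Finset.sum_congr rfl fun m _ ↦ ?_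
  have h1 : Y (a * m + q₂ * c * i) = Y a * Y m := by
    rw [mul_assoc (q₂ : ℤ), hY.add_mul, hYm]
  have h2 : ((a * m + q₂ * c * i : ℤ) : ℝ) / (q₂ * a : ℕ) =
      m / q₂ + (q₂ * (q₁ * c) : ℕ) * i / (q₂ * (q₁ * a : ℕ)) := by
    push_cast; field_simp
  rw [h1, h2]
  ring

theorem twistedSawSum_swap (hX : IsBalanced X q₁ δ) (hY : IsBalanced Y q₂ δ)
    (hXm : ∀ m n, X (m * n) = X m * X n) (hYm : ∀ m n, Y (m * n) = Y m * Y n)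
    (hq₁ : 0 < q₁) (hq₂ : 0 < q₂) {a b c : ℕ} (ha : 0 < a) (hXY : X a = Y a) (hYa : Y a ≠ 0)
    (hbc : (a : ℤ) ∣ q₁ * q₂ * b * c - 1) :
    twistedSawSum X Y q₂ (q₁ * a) (q₂ * (q₁ * c)) =
      twistedSawSum Y X q₁ (q₂ * a) (q₁ * (q₂ * b)) := by
  apply mul_left_cancel₀ hYa
  conv_rhs => rw [← hXY]
  rw [hY.mul_twistedSawSum hYm hq₁ hq₂ ha, hX.mul_twistedSawSum hXm hq₂ hq₁ ha, Finset.sum_comm]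
  refine Finset.sum_congr rfl fun j _ ↦ Finset.sum_congr rfl fun i _ ↦ ?_
  obtain ⟨k, hk⟩ := hbc
  have : (a : ℤ) ∣ j - q₂ * c * i ↔ (a : ℤ) ∣ i - q₁ * b * j := by
    constructor
    · rintro ⟨t, ht⟩
      exact ⟨-(k * i) - q₁ * b * t, by linear_combination (-(q₁ : ℤ) * b) * ht - i * hk⟩
    · rintro ⟨t, ht⟩
      exact ⟨-(k * j) - q₂ * c * t, by linear_combination (-(q₂ : ℤ) * c) * ht - j * hk⟩
  simp only [this]
  split_ifs
  · ring
  · rfl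

theorem mul_twistedSawSum_sub_mem (hX : IsBalanced X q₁ δ) (hY : IsBalanced Y q₂ δ)
    (hδ : δ * δ = 1) (hq₁ : 0 < q₁) (hq₂ : 0 < q₂) {K M : ℕ} (hK : 0 < K) (hM : 0 < M)
    (hd : DiagonalFree X Y (q₁ * K) (q₂ * M)) {R : Subring ℂ} (hXR : ∀ n, X n ∈ R)
    (hYR : ∀ n, Y n ∈ R) :
    (q₁ * K : ℂ) * ((∑ n ∈ range q₁, X n * ((n : ℂ) / q₁)) *
      (∑ n ∈ range q₂, Y n * ((n : ℂ) / q₂)) - twistedSawSum X Y q₂ (q₁ * K) (q₂ * M)) ∈ R := by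
  have hA' : ((q₁ * K : ℕ) : ℂ) ≠ 0 := by exact_mod_cast (Nat.mul_pos hq₁ hK).ne'
  have hδR : δ ∈ R := by
    rcases mul_self_eq_one_iff.mp hδ with rfl | rfl
    · exact R.one_mem
    · exact R.neg_mem R.one_mem
  rw [hX.twistedSawSum_eq hY hδ hq₁ hq₂ hK hM hd, sub_sub_cancel, mul_left_comm, ← Nat.cast_mul,
    Finset.mul_sum]
  refine R.mul_mem hδR (R.sum_mem fun i _ ↦ ?_)
  rw [Finset.mul_sum]
  refine R.sum_mem fun j _ ↦ ?_
  rw [mul_left_comm, mul_div_cancel₀ _ hA']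
  refine R.mul_mem ?_ (natCast_mem R i)
  split_ifs
  · exact R.mul_mem (hXR i) (hYR j)
  · exact R.zero_mem

theorem mul_gcd_mul_twistedSawSum_mem (hX : IsBalanced X q₁ δ) (hY : IsBalanced Y q₂ δ)
    (hXm : ∀ m n, X (m * n) = X m * X n) (hYm : ∀ m n, Y (m * n) = Y m * Y n)
    (hδ : δ * δ = 1) (hq₁ : 0 < q₁) (hq₂ : 0 < q₂) {a c : ℕ} (ha : 0 < a) (hc : 0 < c)
    (hac : a.Coprime (q₁ * q₂ * c)) (hXY : X a = Y a) (hYa : Y a ≠ 0) {R : Subring ℂ}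
    (hXR : ∀ n, X n ∈ R) (hYR : ∀ n, Y n ∈ R) :
    (a : ℂ) * (Nat.gcd q₁ q₂ * twistedSawSum Y X q₁ (q₂ * (q₁ * c)) (q₁ * a)) ∈ R := by
  have haq : a.Coprime (q₁ * q₂) := Nat.Coprime.coprime_mul_right_right hac
  have haq₁ : a.Coprime q₁ := Nat.Coprime.coprime_mul_right_right haq
  have haq₂ : a.Coprime q₂ := Nat.Coprime.coprime_mul_left_right haq
  obtain ⟨b, hb, hbc⟩ : ∃ b : ℕ, 0 < b ∧ (a : ℤ) ∣ q₁ * q₂ * b * c - 1 := by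
    obtain ⟨u, v, huv⟩ := Nat.isCoprime_iff_coprime.mpr hac
    have ha' : (0 : ℤ) < a := by exact_mod_cast ha
    have h0 : 0 ≤ v % a := Int.emod_nonneg _ ha'.ne'
    refine ⟨(v % a + a).toNat, by omega, ?_⟩
    rw [Int.toNat_of_nonneg (by omega)]
    refine ⟨-u + q₁ * q₂ * c * (1 - v / a), ?_⟩
    have := Int.mul_ediv_add_emod v a
    push_cast at huv
    linear_combination huv + (q₁ * q₂ * c : ℤ) * this
  have hrec := hX.twistedSawSum_reciprocity hY hδ hq₁ hq₂ ha hc haq₁ haq₂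
  have h1 := hX.mul_twistedSawSum_sub_mem hY hδ hq₁ hq₂ ha (Nat.mul_pos hq₁ hc)
    (.of_coprime hY hq₁ haq₂ c) hXR hYR
  have h2 := hY.mul_twistedSawSum_sub_mem hX hδ hq₂ hq₁ ha (Nat.mul_pos hq₂ hb)
    (.of_coprime hX hq₂ haq₁ b) hYR hXR
  rw [← hX.twistedSawSum_swap hY hXm hYm hq₁ hq₂ ha hXY hYa hbc, mul_comm (∑ n ∈ range q₂, _)] at h2
  rw [← hrec, add_sub_cancel_left] at h1 h2
  have hg : ((Nat.gcd q₁ q₂ : ℕ) : ℂ) = q₁ * (Nat.gcdA q₁ q₂ : ℤ) + q₂ * (Nat.gcdB q₁ q₂ : ℤ) := by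
    exact_mod_cast congrArg (Int.cast : ℤ → ℂ) (Nat.gcd_eq_gcd_ab q₁ q₂)
  have h3 := R.add_mem (R.mul_mem (intCast_mem R (Nat.gcdA q₁ q₂)) h1)
    (R.mul_mem (intCast_mem R (Nat.gcdB q₁ q₂)) h2)
  convert h3 using 1
  rw [hg]
  ring

end IsBalanced

theorem ZMod.sum_range_natCast {M : Type*} [AddCommMonoid M] {q : ℕ} [NeZero q] (f : ZMod q → M) :
    ∑ s ∈ range q, f s = ∑ x : ZMod q, f x :=
  Finset.sum_nbij' (fun s ↦ (s : ZMod q)) ZMod.val (by simp)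
    (fun x _ ↦ Finset.mem_range.mpr x.val_lt)
    (fun s hs ↦ ZMod.val_cast_of_lt (Finset.mem_range.mp hs))
    (fun x _ ↦ ZMod.natCast_zmod_val x) (by simp)

namespace DirichletCharacter

variable {q : ℕ}

theorem isBalanced_conj (χ : DirichletCharacter ℂ q) (hq : 0 < q) (hχ : χ ≠ 1) :
    IsBalanced (fun n : ℤ ↦ (starRingEnd ℂ) (χ (n : ZMod q))) q (χ (-1)) where
  periodic n := by simp
  sum_progression a ha i := by
    have : NeZero q := ⟨hq.ne'⟩
    let u : ZMod q ≃ ZMod q :=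
      (Units.mulLeft (ZMod.unitOfCoprime a ha)).trans (Equiv.addLeft (i : ZMod q))
    have h := ZMod.sum_range_natCast (fun x : ZMod q ↦ χ (u x))
    rw [Equiv.sum_comp u χ, MulChar.sum_eq_zero_of_ne_one hχ] at h
    rw [← map_sum, ← map_zero (starRingEnd ℂ), ← h]
    simp [u]
  neg n := by
    have h : (starRingEnd ℂ) (χ (-1)) = χ (-1) := by
      rcases χ.even_or_odd with h | h
      · rw [h, map_one]
      · rw [h, map_neg, map_one]
    rw [Int.cast_neg, ← neg_one_mul, map_mul, map_mul, h]
  zero := by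
    have : Fact (1 < q) := by
      refine ⟨lt_of_le_of_ne hq fun h ↦ hχ ?_⟩
      subst h
      exact level_one χ
    rw [Int.cast_zero, MulChar.map_zero, map_zero]

theorem conj_apply_mem_range (χ : DirichletCharacter ℂ q) (hq : 0 < q) (x : ZMod q) :
    (starRingEnd ℂ) (χ x) ∈ Set.range χ := by
  have : NeZero q := ⟨hq.ne'⟩
  exact ⟨Ring.inverse x, by rw [starRingEnd_apply, MulChar.star_apply', MulChar.inv_apply]⟩

theorem isIntegral_conj_apply (χ : DirichletCharacter ℂ q) (hq : 0 < q) (x : ZMod q) :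
    IsIntegral ℤ ((starRingEnd ℂ) (χ x)) := by
  have : NeZero q := ⟨hq.ne'⟩
  obtain ⟨y, hy⟩ := χ.conj_apply_mem_range hq x
  rw [← hy]
  by_cases h : IsUnit y
  · obtain ⟨u, rfl⟩ := h
    refine .of_pow (Fintype.card_pos (α := (ZMod q)ˣ)) ?_
    rw [← map_pow, ← Units.val_pow_eq_pow_val, pow_card_eq_one, Units.val_one, map_one]
    exact isIntegral_one
  · rw [χ.map_nonunit h]
    exact isIntegral_zero

end DirichletCharacter

section

variable {q₁ q₂ : ℕ} (χ₁ : DirichletCharacter ℂ q₁) (χ₂ : DirichletCharacter ℂ q₂)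

theorem newformDedekindSum_natCast (hq₁ : 0 < q₁) (a c : ℕ) :
    newformDedekindSum χ₁ χ₂ a c =
      twistedSawSum (fun n ↦ (starRingEnd ℂ) (χ₂ (n : ZMod q₂)))
        (fun n ↦ (starRingEnd ℂ) (χ₁ (n : ZMod q₁))) q₁ c (q₁ * a) := by
  have hq₁' : (q₁ : ℝ) ≠ 0 := by exact_mod_cast hq₁.ne'
  rw [newformDedekindSum, twistedSawSum, Int.toNat_natCast]
  refine Finset.sum_congr rfl fun j _ ↦ Finset.sum_congr rfl fun n _ ↦ ?_
  have : ((q₁ * a : ℕ) : ℝ) * j / (q₁ * c) = a * j / c := by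
    push_cast
    rw [mul_assoc, mul_div_mul_left _ _ hq₁']
  simp only [this, Int.cast_natCast]

theorem newformDedekindSum_add_mul (a t : ℤ) {c : ℤ} (hc : 0 < c) :
    newformDedekindSum χ₁ χ₂ (a + t * c) c = newformDedekindSum χ₁ χ₂ a c := by
  have hc' : (c : ℝ) ≠ 0 := by exact_mod_cast hc.ne'
  refine Finset.sum_congr rfl fun j _ ↦ Finset.sum_congr rfl fun n _ ↦ ?_
  have : (n : ℝ) / q₁ + (a + t * c : ℤ) * j / c = n / q₁ + a * j / c + (t * j : ℤ) := by
    push_cast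
    field_simp
    ring
  rw [this, sawtooth_add_int]

/-- The ring of integers of the field generated by the values of two characters. -/
noncomputable def characterIntegers : Subring ℂ :=
  (Subfield.closure (Set.range (χ₁ : ZMod q₁ → ℂ) ∪ Set.range (χ₂ : ZMod q₂ → ℂ))).toSubring ⊓
    (integralClosure ℤ ℂ).toSubring

theorem mem_characterIntegers {x : ℂ} :
    x ∈ characterIntegers χ₁ χ₂ ↔ InRingOfIntegers χ₁ χ₂ x := Iff.rfl

theorem gcd_mul_newformDedekindSum_mem (hq₁ : 0 < q₁) (hq₂ : 0 < q₂) (hχ₁ : χ₁ ≠ 1)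
    (hχ₂ : χ₂ ≠ 1) (hpar : χ₁ (-1) * χ₂ (-1) = 1) {a c : ℤ} (hc : 0 < c)
    (hN : ((q₁ * q₂ : ℕ) : ℤ) ∣ c) (hac : IsCoprime a c) (ha : χ₁ a = χ₂ a) :
    (Nat.gcd q₁ q₂ : ℂ) * newformDedekindSum χ₁ χ₂ a c ∈ characterIntegers χ₁ χ₂ := by
  have hsq : χ₁ (-1) * χ₁ (-1) = 1 := by rw [← map_mul]; simp
  have hpar' : χ₂ (-1) = χ₁ (-1) := by
    linear_combination χ₁ (-1) * hpar - χ₂ (-1) * hsq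
  have hX := χ₁.isBalanced_conj hq₁ hχ₁
  have hY := χ₂.isBalanced_conj hq₂ hχ₂
  rw [hpar'] at hY
  have key : ∀ a' : ℕ, 0 < a' → (∃ t, (a' : ℤ) = a + t * c) →
      (a' : ℂ) * ((Nat.gcd q₁ q₂ : ℂ) * newformDedekindSum χ₁ χ₂ a c) ∈
        characterIntegers χ₁ χ₂ := by
    rintro a' ha' ⟨t, ht⟩
    obtain ⟨d, hd⟩ := hN
    have hd0 : 0 < d := pos_of_mul_pos_right (hd ▸ hc) (by positivity)
    lift d to ℕ using hd0.le
    have hac' : IsCoprime (a' : ℤ) c := by rw [ht]; exact hac.add_mul_right_left t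
    have hcop : a'.Coprime (q₁ * q₂ * d) := by
      rw [← Nat.isCoprime_iff_coprime]
      push_cast at hd ⊢
      rwa [← hd]
    have hz₁ : ((a' : ℤ) : ZMod q₁) = (a : ZMod q₁) := by
      rw [ht, hd]; push_cast; simp
    have hz₂ : ((a' : ℤ) : ZMod q₂) = (a : ZMod q₂) := by
      rw [ht, hd]; push_cast; simp
    have hu : IsUnit ((a' : ℤ) : ZMod q₂) := by
      rw [Int.cast_natCast, ZMod.isUnit_iff_coprime]
      exact hcop.coprime_mul_right_right.coprime_mul_left_right
    have h := hX.mul_gcd_mul_twistedSawSum_mem hY (fun m n ↦ by simp) (fun m n ↦ by simp) hsq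
      hq₁ hq₂ ha' (by exact_mod_cast hd0) hcop (by simp only [hz₁, hz₂, ha])
      ((map_ne_zero _).mpr (hu.map χ₂).ne_zero) (R := characterIntegers χ₁ χ₂)
      (fun n ↦ ⟨Subfield.subset_closure (.inl (χ₁.conj_apply_mem_range hq₁ _)),
        χ₁.isIntegral_conj_apply hq₁ _⟩)
      (fun n ↦ ⟨Subfield.subset_closure (.inr (χ₂.conj_apply_mem_range hq₂ _)),
        χ₂.isIntegral_conj_apply hq₂ _⟩)
    rw [← newformDedekindSum_natCast χ₁ χ₂ hq₁, ht] at h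
    have hdc : ((q₂ * (q₁ * d) : ℕ) : ℤ) = c := by rw [hd]; push_cast; ring
    rwa [hdc, newformDedekindSum_add_mul χ₁ χ₂ a t hc] at h
  set s := (Nat.gcd q₁ q₂ : ℂ) * newformDedekindSum χ₁ χ₂ a c
  have hpos : 0 < a + |a| * c + c := by
    nlinarith [neg_abs_le a, abs_nonneg a, mul_nonneg (abs_nonneg a) (by omega : 0 ≤ c - 1)]
  obtain ⟨u, hu⟩ := Int.eq_ofNat_of_zero_le hpos.le
  obtain ⟨v, hv⟩ := Int.eq_ofNat_of_zero_le (by omega : 0 ≤ a + |a| * c + c + c)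
  have h1 := key u (by omega) ⟨|a| + 1, by rw [← hu]; ring⟩
  have h2 := key v (by omega) ⟨|a| + 2, by rw [← hv]; ring⟩
  have hco : IsCoprime (u : ℤ) v := by
    have h3 : IsCoprime (u : ℤ) c := by
      rw [← hu, add_assoc, ← add_one_mul]; exact hac.add_mul_right_left _
    rw [← hv, hu, add_comm]
    simpa using h3.add_mul_left_right 1
  obtain ⟨x, y, hxy⟩ := hco
  have h3 := add_mem (mul_mem (intCast_mem (characterIntegers χ₁ χ₂) x) h1)
    (mul_mem (intCast_mem (characterIntegers χ₁ χ₂) y) h2)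
  have h4 : (x : ℂ) * u + y * v = 1 := by exact_mod_cast congrArg (Int.cast : ℤ → ℂ) hxy
  convert h3 using 1
  linear_combination (-s) * h4

end

theorem newform_dedekind_sum_gamma1_denominator_gcd {q₁ q₂ : ℕ} (hq₁ : 0 < q₁) (hq₂ : 0 < q₂)
    (χ₁ : DirichletCharacter ℂ q₁) (χ₂ : DirichletCharacter ℂ q₂)
    (hχ₁ : χ₁ ≠ 1) (hχ₂ : χ₂ ≠ 1) (hp₁ : χ₁.IsPrimitive) (hp₂ : χ₂.IsPrimitive)
    (hpar : χ₁ (-1) * χ₂ (-1) = 1) :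
    ∀ γ : Matrix.SpecialLinearGroup (Fin 2) ℤ, InGamma1 (q₁ * q₂) γ →
      InRingOfIntegers χ₁ χ₂ ((Nat.gcd q₁ q₂ : ℂ) * newformDedekindSumSL χ₁ χ₂ γ) := by
  rintro γ ⟨hc, ha, -⟩
  rw [← mem_characterIntegers, newformDedekindSumSL]
  have hdet := γ.2
  rw [Matrix.det_fin_two] at hdet
  have hcop : IsCoprime (γ.1 0 0) (γ.1 1 0) :=
    ⟨γ.1 1 1, -γ.1 0 1, by linear_combination hdet⟩
  have h₁ : ((γ.1 0 0 : ℤ) : ZMod q₁) = 1 := by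
    have := (ZMod.intCast_zmod_eq_zero_iff_dvd _ q₁).mpr
      ((Dvd.intro _ (Nat.cast_mul q₁ q₂).symm).trans ha)
    rw [Int.cast_sub, Int.cast_one] at this
    exact sub_eq_zero.mp this
  have h₂ : ((γ.1 0 0 : ℤ) : ZMod q₂) = 1 := by
    have := (ZMod.intCast_zmod_eq_zero_iff_dvd _ q₂).mpr
      ((Dvd.intro_left _ (Nat.cast_mul q₁ q₂).symm).trans ha)
    rw [Int.cast_sub, Int.cast_one] at this
    exact sub_eq_zero.mp this
  split_ifs with h0 h1
  · rw [mul_zero]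
    exact zero_mem _
  · exact gcd_mul_newformDedekindSum_mem χ₁ χ₂ hq₁ hq₂ hχ₁ hχ₂ hpar (by omega) hc hcop
      (by rw [h₁, h₂, map_one, map_one])
  · refine gcd_mul_newformDedekindSum_mem χ₁ χ₂ hq₁ hq₂ hχ₁ hχ₂ hpar (by omega)
      (dvd_neg.mpr hc) hcop.neg_neg ?_
    have hsq : χ₁ (-1) * χ₁ (-1) = 1 := by rw [← map_mul]; simp
    rw [Int.cast_neg, Int.cast_neg, h₁, h₂]
    linear_combination χ₂ (-1) * hsq - χ₁ (-1) * hpar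
end

section
/- Suppose χ₁ and χ₂ are quadratic and q₁, q₂ > 4 are odd. Then for every γ ∈ Γ₀(q₁q₂), gcd(q₁,q₂)·S_{χ₁,χ₂}(γ) is a rational integer; that is, S_{χ₁,χ₂}(Γ₀(q₁q₂)) ⊆ (1/gcd(q₁,q₂))·ℤ. -/
open Complex Finset
open scoped Classical

/-- A sum over `0 ≤ k < q` of a function of `k mod q` is a sum over `ZMod q`. -/
theorem sum_range_natCast_zmod {A : Type*} [AddCommMonoid A] (q : ℕ) [NeZero q]
    (φ : ZMod q → A) : ∑ v ∈ range q, φ (v : ZMod q) = ∑ z, φ z := by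
  refine Finset.sum_nbij' (fun v => (v : ZMod q)) ZMod.val ?_ ?_ ?_ ?_ ?_
  · simp
  · intro z _
    simpa using ZMod.val_lt z
  · intro v hv
    exact ZMod.val_cast_of_lt (by simpa using hv)
  · intro z _
    simp
  · simp

/-- Multiplication by a unit mod `c` permutes the residues mod `c`. -/
theorem sum_range_mul_unit {A : Type*} [AddCommMonoid A] (c : ℕ) [NeZero c] (u : ℤ → A)
    (hu : ∀ k l : ℤ, (c : ℤ) ∣ k - l → u k = u l) (a d : ℤ) (had : (c : ℤ) ∣ a * d - 1) :
    ∑ j ∈ range c, u (a * j) = ∑ k ∈ range c, u k := by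
  have had' : (a : ZMod c) * (d : ZMod c) = 1 := by
    rw [← Int.cast_mul, ← Int.cast_one, ← sub_eq_zero, ← Int.cast_sub]
    exact (ZMod.intCast_zmod_eq_zero_iff_dvd _ _).2 had
  let e : (ZMod c)ˣ := ⟨a, d, had', by rw [mul_comm, had']⟩
  let φ : ZMod c → A := fun z => u (z.val : ℤ)
  have hφ : ∀ k : ℤ, φ (k : ZMod c) = u k := by
    intro k
    apply hu
    rw [← ZMod.intCast_zmod_eq_zero_iff_dvd]
    simp
  have h1 : ∑ j ∈ range c, u (a * j) = ∑ j ∈ range c, φ ((e : ZMod c) * (j : ZMod c)) := by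
    refine Finset.sum_congr rfl fun j _ => ?_
    rw [← hφ]
    simp [e]
  have h2 : ∑ j ∈ range c, u j = ∑ j ∈ range c, φ (j : ZMod c) := by
    refine Finset.sum_congr rfl fun j _ => ?_
    rw [← hφ]
    simp
  rw [h1, h2, sum_range_natCast_zmod c (fun z => φ ((e : ZMod c) * z)),
    sum_range_natCast_zmod c φ]
  exact Equiv.sum_comp (Units.mulLeft e) φ

theorem sum_range_mul_eq_sum_sum {A : Type*} [AddCommMonoid A] (q m : ℕ) (φ : ℕ → A) :
    ∑ k ∈ range (q * m), φ k = ∑ r ∈ range q, ∑ s ∈ range m, φ (r * m + s) := by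
  induction q with
  | zero => simp
  | succ q ih => rw [Nat.succ_mul, Finset.sum_range_add, ih, Finset.sum_range_succ]

/-- Hermite's identity for integers. -/
theorem sum_range_add_ediv (q n : ℕ) (hq : 0 < q) :
    ∑ r ∈ range q, (((n : ℤ) + r) / q) = n := by
  induction n with
  | zero =>
    refine (Finset.sum_eq_zero fun r hr => ?_).trans (by simp)
    have : r < q := by simpa using hr
    exact Int.ediv_eq_zero_of_lt (by positivity) (by push_cast; omega)
  | succ n ih =>
    have h1 := Finset.sum_range_succ (fun r : ℕ => ((n : ℤ) + r) / q) q
    have h2 := Finset.sum_range_succ' (fun r : ℕ => ((n : ℤ) + r) / q) q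
    have h3 : ((n : ℤ) + q) / q = n / q + 1 := by
      rw [Int.add_ediv_of_dvd_right (dvd_refl _), Int.ediv_self (by omega)]
    have h4 : ∑ r ∈ range q, (((n + 1 : ℕ) : ℤ) + r) / q
        = ∑ r ∈ range q, ((n : ℤ) + (r + 1 : ℕ)) / q := by
      refine Finset.sum_congr rfl fun r _ => ?_
      push_cast
      ring_nf
    rw [h4]
    simp only [Nat.cast_zero, add_zero] at h2
    push_cast at *
    linarith

/-- A Dirichlet character with `χ ^ 2 = 1` comes from an integer-valued function. -/
theorem DirichletCharacter.exists_int_of_sq_eq_one {q : ℕ} (χ : DirichletCharacter ℂ q)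
    (h : χ ^ 2 = 1) : ∃ E : ZMod q → ℤ, ∀ z, ((E z : ℤ) : ℂ) = χ z := by
  have key : ∀ z, ∃ e : ℤ, (e : ℂ) = χ z := by
    intro z
    by_cases hz : IsUnit z
    · have h2 : χ z ^ 2 = 1 := by
        rw [← MulChar.pow_apply' χ two_ne_zero, h, MulChar.one_apply hz]
      rcases sq_eq_one_iff.1 h2 with h3 | h3
      · exact ⟨1, by simp [h3]⟩
      · exact ⟨-1, by simp [h3]⟩
    · exact ⟨0, by simp [MulChar.map_nonunit χ hz]⟩
  exact ⟨fun z => (key z).choose, fun z => (key z).choose_spec⟩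

/-- For a primitive quadratic character of odd conductor `q > 4`, the generalized Bernoulli
number `B_{1,χ}` is an integer. -/
theorem DirichletCharacter.dvd_sum_mul_of_quadratic {q : ℕ} (χ : DirichletCharacter ℂ q)
    (hp : χ.IsPrimitive) (hodd : _root_.Odd q) (h4 : 4 < q) (E : ZMod q → ℤ)
    (hE : ∀ z, ((E z : ℤ) : ℂ) = χ z) (hquad : χ ^ 2 = 1) :
    (q : ℤ) ∣ ∑ n ∈ range q, E (n : ZMod q) * n := by
  have : NeZero q := ⟨by omega⟩
  have hmul : ∀ x y, E (x * y) = E x * E y := by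
    intro x y
    have : ((E (x * y) : ℤ) : ℂ) = ((E x * E y : ℤ) : ℂ) := by
      push_cast
      rw [hE, hE, hE, map_mul]
    exact_mod_cast this
  have hval : ∀ u : (ZMod q)ˣ, E u = 1 ∨ E u = -1 := by
    intro u
    have h2 : χ u ^ 2 = 1 := by
      rw [← MulChar.pow_apply' χ two_ne_zero, hquad, MulChar.one_apply u.isUnit]
    rw [← hE] at h2
    have h3 : E u ^ 2 = 1 := by exact_mod_cast h2
    exact sq_eq_one_iff.1 h3
  rw [← ZMod.intCast_zmod_eq_zero_iff_dvd]
  push_cast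
  rw [sum_range_natCast_zmod q (fun z => (E z : ZMod q) * z)]
  set A : ZMod q := ∑ z, (E z : ZMod q) * z with hA
  have hinv : ∀ u : (ZMod q)ˣ, A = (E u : ZMod q) * u * A := by
    intro u
    rw [hA, Finset.mul_sum]
    rw [← Equiv.sum_comp (Units.mulLeft u)]
    refine Finset.sum_congr rfl fun z _ => ?_
    simp only [Units.mulLeft_apply, hmul]
    push_cast
    ring
  have hc2 : Nat.Coprime 2 q := (Nat.coprime_two_left).2 hodd
  have h2 := hinv (ZMod.unitOfCoprime 2 hc2)
  have h3A : 3 * A = 0 := by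
    rcases hval (ZMod.unitOfCoprime 2 hc2) with h | h <;>
      rw [h] at h2 <;> simp only [ZMod.coe_unitOfCoprime] at h2 <;> push_cast at h2
    · linear_combination (-3 : ZMod q) * h2
    · linear_combination h2
  by_cases h3 : 3 ∣ q
  · obtain ⟨u, hu1, hu2⟩ : ∃ u : (ZMod q)ˣ, ZMod.unitsMap h3 u = 1 ∧ E u = -1 := by
      by_contra! hcon
      have hft : χ.FactorsThrough 3 := by
        rw [DirichletCharacter.factorsThrough_iff_ker_unitsMap h3]
        intro u hu
        rw [MonoidHom.mem_ker] at hu ⊢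
        have h1 : E u = 1 := (hval u).resolve_right (hcon u hu)
        ext
        rw [MulChar.coe_toUnitHom, ← hE, h1]
        simp
      have h5 : χ.conductor ≤ 3 := Nat.sInf_le hft
      rw [DirichletCharacter.isPrimitive_def] at hp
      omega
    have hmod : ∃ t : ℤ, ((u : ZMod q)) = 1 + 3 * (t : ZMod q) := by
      have h6 : ZMod.castHom h3 (ZMod 3) (u : ZMod q) = 1 := by
        have := congrArg (Units.val) hu1
        simpa [ZMod.unitsMap_def] using this
      have h7 : (3 : ℤ) ∣ ((u : ZMod q).val : ℤ) - 1 := by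
        have h8 : (((((u : ZMod q).val : ℤ) - 1 : ℤ)) : ZMod 3) = 0 := by
          push_cast
          rw [← h6, ← map_natCast (ZMod.castHom h3 (ZMod 3)), ZMod.natCast_zmod_val, sub_self]
        exact (ZMod.intCast_zmod_eq_zero_iff_dvd _ 3).1 h8
      obtain ⟨t, ht⟩ := h7
      refine ⟨t, ?_⟩
      have h9 : ((u : ZMod q).val : ℤ) = 1 + 3 * t := by omega
      have h10 := congrArg (fun x : ℤ => (x : ZMod q)) h9
      push_cast at h10
      rwa [ZMod.natCast_zmod_val] at h10
    obtain ⟨t, ht⟩ := hmod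
    have h11 := hinv u
    rw [hu2, ht] at h11
    push_cast at h11
    linear_combination (-1 : ZMod q) * h11 + (1 + t) * h3A
  · have hc3 : Nat.Coprime 3 q := (Nat.Prime.coprime_iff_not_dvd Nat.prime_three).2 h3
    have hu := (ZMod.unitOfCoprime 3 hc3).isUnit
    rw [ZMod.coe_unitOfCoprime] at hu
    exact (hu.mul_right_eq_zero).1 (by exact_mod_cast h3A)

theorem sum_range_int_eq_zero {q : ℕ} [NeZero q] (χ : DirichletCharacter ℂ q) (hχ : χ ≠ 1)
    (E : ZMod q → ℤ) (hE : ∀ z, ((E z : ℤ) : ℂ) = χ z) :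
    ∑ n ∈ range q, E (n : ZMod q) = 0 := by
  rw [sum_range_natCast_zmod q E]
  have h : ((∑ z, E z : ℤ) : ℂ) = 0 := by
    push_cast
    simp_rw [hE]
    exact MulChar.sum_eq_zero_of_ne_one hχ
  exact_mod_cast h

/-- The sawtooth at a point `n / q + k / (q m)` with `m ∤ k`. -/
theorem sawtooth_div_add_div (q m : ℕ) (hq : 0 < q) (hm : 0 < m) (n k : ℤ) (hk : ¬ (m : ℤ) ∣ k) :
    sawtooth ((n : ℝ) / q + (k : ℝ) / ((q * m : ℕ) : ℝ)) =
      (n : ℝ) / q + (k : ℝ) / ((q * m : ℕ) : ℝ) - (((n + k / m) / q : ℤ) : ℝ) - 1 / 2 := by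
  have hq' : (0 : ℝ) < q := by exact_mod_cast hq
  have hm' : (0 : ℝ) < m := by exact_mod_cast hm
  have hy : (n : ℝ) / q + (k : ℝ) / ((q * m : ℕ) : ℝ)
      = ((n * m + k : ℤ) : ℝ) / ((m * q : ℕ) : ℝ) := by
    push_cast
    field_simp
  have hfl : ⌊(n : ℝ) / q + (k : ℝ) / ((q * m : ℕ) : ℝ)⌋ = (n + k / m) / q := by
    have hy' : (n : ℝ) / q + (k : ℝ) / ((q * m : ℕ) : ℝ)
        = ((n * m + k : ℤ) : ℝ) / (m : ℝ) / (q : ℝ) := by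
      push_cast
      field_simp
    rw [hy', Int.floor_div_natCast, Int.floor_div_natCast, Int.floor_intCast, add_comm,
      Int.add_mul_ediv_right _ _ (by exact_mod_cast hm.ne'), add_comm]
  have hni : ¬ ∃ t : ℤ, (t : ℝ) = (n : ℝ) / q + (k : ℝ) / ((q * m : ℕ) : ℝ) := by
    rintro ⟨t, ht⟩
    rw [hy, eq_div_iff (by positivity)] at ht
    have h1 : t * (m * q : ℕ) = n * m + k := by exact_mod_cast ht
    apply hk
    refine ⟨t * q - n, ?_⟩
    push_cast at h1
    linear_combination -h1
  rw [sawtooth, if_neg hni, Int.fract, hfl]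

/-- The newform Dedekind sum is an integer whenever `B_{1,χ₁}` is. -/
theorem newformDedekindSum_eq_int {q₁ q₂ : ℕ} (hq₁ : 0 < q₁) (hq₂ : 0 < q₂)
    (χ₁ : DirichletCharacter ℂ q₁) (χ₂ : DirichletCharacter ℂ q₂)
    (hχ₁ : χ₁ ≠ 1) (hχ₂ : χ₂ ≠ 1) (E₁ : ZMod q₁ → ℤ) (E₂ : ZMod q₂ → ℤ)
    (hE₁ : ∀ z, ((E₁ z : ℤ) : ℂ) = χ₁ z) (hE₂ : ∀ z, ((E₂ z : ℤ) : ℂ) = χ₂ z)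
    (hB : (q₁ : ℤ) ∣ ∑ n ∈ range q₁, E₁ (n : ZMod q₁) * n)
    (a d c : ℤ) (hc : 0 < c) (hcd : ((q₁ * q₂ : ℕ) : ℤ) ∣ c) (had : c ∣ a * d - 1) :
    ∃ z : ℤ, newformDedekindSum χ₁ χ₂ a c = z := by
  have : NeZero q₁ := ⟨hq₁.ne'⟩
  have : NeZero q₂ := ⟨hq₂.ne'⟩
  lift c to ℕ using hc.le
  have hc' : 0 < c := by exact_mod_cast hc
  have : NeZero c := ⟨hc'.ne'⟩
  obtain ⟨t, ht⟩ : q₁ * q₂ ∣ c := by exact_mod_cast hcd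
  obtain ⟨m, hm⟩ : ∃ m, m = t * q₂ := ⟨_, rfl⟩
  have hcm : c = q₁ * m := by rw [ht, hm]; ring
  have hm0 : 0 < m := Nat.pos_of_mul_pos_left (hcm ▸ hc')
  obtain ⟨H, hH⟩ := hB
  have hs₁ := sum_range_int_eq_zero χ₁ hχ₁ E₁ hE₁
  have hs₂ := sum_range_int_eq_zero χ₂ hχ₂ E₂ hE₂
  have hmul₂ : ∀ x y, E₂ (x * y) = E₂ x * E₂ y := by
    intro x y
    have : ((E₂ (x * y) : ℤ) : ℂ) = ((E₂ x * E₂ y : ℤ) : ℂ) := by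
      push_cast
      rw [hE₂, hE₂, hE₂, map_mul]
    exact_mod_cast this
  have hzero₂ : E₂ 0 = 0 := by
    have hne : q₂ ≠ 1 := by
      rintro rfl
      exact hχ₂ (DirichletCharacter.level_one χ₂)
    have : Nontrivial (ZMod q₂) := ZMod.nontrivial_iff.2 hne
    have : ((E₂ 0 : ℤ) : ℂ) = 0 := by
      rw [hE₂]
      exact MulChar.map_zero χ₂
    exact_mod_cast this
  have hcop : IsCoprime (m : ℤ) a := by
    obtain ⟨w, hw⟩ := had
    refine ⟨-(q₁ * w), d, ?_⟩
    rw [hcm] at hw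
    push_cast at hw
    linear_combination hw
  -- `g k` is the inner sum at `x = k / c`
  let P : ℤ → ℤ := fun r => ∑ n ∈ range q₁, E₁ (n : ZMod q₁) * (((n : ℤ) + r) / q₁)
  let g : ℤ → ℤ := fun k => H - P (k / m)
  have hg : ∀ k : ℤ, ¬ (m : ℤ) ∣ k →
      ∑ n ∈ range q₁, (E₁ (n : ZMod q₁) : ℝ) * sawtooth ((n : ℝ) / q₁ + (k : ℝ) / (c : ℝ)) = g k := by
    intro k hk
    have hterm : ∀ n ∈ range q₁,
        (E₁ (n : ZMod q₁) : ℝ) * sawtooth ((n : ℝ) / q₁ + (k : ℝ) / (c : ℝ)) =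
        ((E₁ (n : ZMod q₁) * n : ℤ) : ℝ) / q₁ + (E₁ (n : ZMod q₁) : ℝ) * ((k : ℝ) / c - 1 / 2)
          - ((E₁ (n : ZMod q₁) * (((n : ℤ) + k / m) / q₁) : ℤ) : ℝ) := by
      intro n _
      have h := sawtooth_div_add_div q₁ m hq₁ hm0 n k hk
      rw [← hcm] at h
      rw [Int.cast_natCast] at h
      rw [h]
      push_cast
      ring
    rw [Finset.sum_congr rfl hterm, Finset.sum_sub_distrib, Finset.sum_add_distrib,
      ← Finset.sum_div, ← Finset.sum_mul, ← Int.cast_sum, ← Int.cast_sum, ← Int.cast_sum, hs₁, hH]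
    have hq₁' : (q₁ : ℝ) ≠ 0 := by exact_mod_cast hq₁.ne'
    simp only [g, P]
    push_cast
    field_simp
    ring
  have hgper : ∀ k l : ℤ, (c : ℤ) ∣ k - l → g k = g l := by
    rintro k l ⟨w, hw⟩
    have h1 : k / m = l / m + q₁ * w := by
      have : k = l + m * (q₁ * w) := by
        rw [hcm] at hw
        push_cast at hw
        linear_combination hw
      rw [this, Int.add_mul_ediv_left _ _ (by exact_mod_cast hm0.ne')]
    have h2 : P (l / m + q₁ * w) = P (l / m) := by
      simp only [P]
      have : ∀ n ∈ range q₁, E₁ (n : ZMod q₁) * (((n : ℤ) + (l / m + q₁ * w)) / q₁) =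
          E₁ (n : ZMod q₁) * (((n : ℤ) + l / m) / q₁) + E₁ (n : ZMod q₁) * w := by
        intro n _
        rw [← add_assoc, Int.add_mul_ediv_left _ _ (by exact_mod_cast hq₁.ne')]
        ring
      rw [Finset.sum_congr rfl this, Finset.sum_add_distrib, ← Finset.sum_mul, hs₁]
      ring
    simp only [g]
    rw [h1, h2]
  have hsum_m : ∑ s ∈ range m, E₂ (s : ZMod q₂) = 0 := by
    rw [hm, sum_range_mul_eq_sum_sum]
    refine Finset.sum_eq_zero fun r _ => ?_
    simpa using hs₂
  have hsumP : ∑ r ∈ range q₁, (H - P r) = 0 := by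
    rw [Finset.sum_sub_distrib]
    simp only [P]
    rw [Finset.sum_comm]
    simp_rw [← Finset.mul_sum]
    simp_rw [sum_range_add_ediv q₁ _ hq₁, hH]
    simp
  have hmz : (m : ZMod q₂) = 0 := by rw [hm]; simp
  have hgrs : ∀ r s : ℕ, s < m → g ((r * m + s : ℕ) : ℤ) = H - P r := by
    intro r s hs
    simp only [g]
    rw [← Int.natCast_div, Nat.mul_comm, Nat.mul_add_div hm0, Nat.div_eq_of_lt hs, add_zero]
  have hN0 : ∑ k ∈ range c, E₂ (k : ZMod q₂) * g k = 0 := by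
    rw [hcm, sum_range_mul_eq_sum_sum]
    refine Finset.sum_eq_zero fun r _ => ?_
    have : ∀ s ∈ range m, E₂ ((r * m + s : ℕ) : ZMod q₂) * g ((r * m + s : ℕ) : ℤ)
        = E₂ (s : ZMod q₂) * (H - P r) := by
      intro s hs
      rw [hgrs r s (by simpa using hs)]
      simp [hmz]
    rw [Finset.sum_congr rfl this, ← Finset.sum_mul, hsum_m, zero_mul]
  have hN1 : ∑ k ∈ range c, (k : ℤ) * E₂ (k : ZMod q₂) * g k = 0 := by
    rw [hcm, sum_range_mul_eq_sum_sum]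
    have : ∀ r ∈ range q₁, ∑ s ∈ range m,
        ((r * m + s : ℕ) : ℤ) * E₂ ((r * m + s : ℕ) : ZMod q₂) * g ((r * m + s : ℕ) : ℤ)
        = (H - P r) * ∑ s ∈ range m, (s : ℤ) * E₂ (s : ZMod q₂) := by
      intro r _
      have : ∀ s ∈ range m,
          ((r * m + s : ℕ) : ℤ) * E₂ ((r * m + s : ℕ) : ZMod q₂) * g ((r * m + s : ℕ) : ℤ)
          = E₂ (s : ZMod q₂) * ((H - P r) * (r * m)) + (H - P r) * (s * E₂ (s : ZMod q₂)) := by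
        intro s hs
        rw [hgrs r s (by simpa using hs)]
        simp only [Nat.cast_add, Nat.cast_mul, hmz, mul_zero, zero_add]
        ring
      rw [Finset.sum_congr rfl this, Finset.sum_add_distrib, ← Finset.sum_mul, hsum_m, zero_mul,
        zero_add, ← Finset.mul_sum]
    rw [Finset.sum_congr rfl this, ← Finset.sum_mul, hsumP, zero_mul]
  have hq₂c : (q₂ : ℤ) ∣ c := ⟨q₁ * t, by rw [ht]; push_cast; ring⟩
  have hEper : ∀ k l : ℤ, (c : ℤ) ∣ k - l → E₂ (k : ZMod q₂) = E₂ (l : ZMod q₂) := by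
    intro k l h
    have : ((k - l : ℤ) : ZMod q₂) = 0 :=
      (ZMod.intCast_zmod_eq_zero_iff_dvd _ _).2 (hq₂c.trans h)
    push_cast at this
    rw [sub_eq_zero.1 this]
  have hEd : ∀ j : ℕ, E₂ (j : ZMod q₂) = E₂ (d : ZMod q₂) * E₂ ((a * j : ℤ) : ZMod q₂) := by
    intro j
    rw [← hmul₂, ← Int.cast_mul, ← Int.cast_natCast (R := ZMod q₂) j]
    apply hEper
    have : (j : ℤ) - d * (a * j) = (a * d - 1) * (-j) := by ring
    rw [this]
    exact had.mul_right _
  have hM0 : ∑ j ∈ range c, E₂ (j : ZMod q₂) * g (a * j) = 0 := by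
    have h := sum_range_mul_unit c (fun k => E₂ (k : ZMod q₂) * g k)
      (fun k l h => by simp only [hgper k l h, hEper k l h]) a d had
    simp only [Int.cast_natCast] at h
    rw [hN0] at h
    simp_rw [hEd, mul_assoc]
    rw [← Finset.mul_sum, h, mul_zero]
  have hM1 : (c : ℤ) ∣ ∑ j ∈ range c, (j : ℤ) * E₂ (j : ZMod q₂) * g (a * j) := by
    rw [← ZMod.intCast_zmod_eq_zero_iff_dvd]
    have h := sum_range_mul_unit c
      (fun k => (k : ZMod c) * (E₂ (k : ZMod q₂) : ZMod c) * (g k : ZMod c))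
      (fun k l h => by
        have hkl : (k : ZMod c) = l := by
          rw [← sub_eq_zero, ← Int.cast_sub]
          exact (ZMod.intCast_zmod_eq_zero_iff_dvd _ _).2 h
        simp only [hgper k l h, hEper k l h, hkl]) a d had
    have hN1' := congrArg (fun x : ℤ => (x : ZMod c)) hN1
    push_cast at hN1'
    simp only [Int.cast_natCast] at h
    rw [hN1'] at h
    have had' : (a : ZMod c) * (d : ZMod c) = 1 := by
      rw [← Int.cast_mul, ← Int.cast_one, ← sub_eq_zero, ← Int.cast_sub]
      exact (ZMod.intCast_zmod_eq_zero_iff_dvd _ _).2 had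
    have hj : ∀ j ∈ range c, (((j : ℤ) * E₂ (j : ZMod q₂) * g (a * j) : ℤ) : ZMod c) =
        (d : ZMod c) * (E₂ (d : ZMod q₂) : ZMod c) *
        (((a * j : ℤ) : ZMod c) * (E₂ ((a * j : ℤ) : ZMod q₂) : ZMod c) * (g (a * j) : ZMod c)) := by
      intro j _
      rw [hEd j]
      simp only [Int.cast_mul, Int.cast_natCast]
      linear_combination (-(j : ZMod c) * (E₂ (d : ZMod q₂) : ZMod c) *
        (E₂ ((a : ZMod q₂) * (j : ZMod q₂)) : ZMod c) * (g (a * j) : ZMod c)) * had'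
    rw [Int.cast_sum, Finset.sum_congr rfl hj, ← Finset.mul_sum, h, mul_zero]
  obtain ⟨z, hz⟩ := hM1
  refine ⟨z, ?_⟩
  have hS : newformDedekindSum χ₁ χ₂ a c =
      ((∑ j ∈ range c, ((E₂ (j : ZMod q₂) : ℝ) * sawtooth ((j : ℝ) / c) *
        ∑ n ∈ range q₁, (E₁ (n : ZMod q₁) : ℝ) *
          sawtooth ((n : ℝ) / q₁ + ((a * j : ℤ) : ℝ) / (c : ℝ)) : ℝ) : ℝ) : ℂ) := by
    rw [newformDedekindSum, Int.toNat_natCast]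
    push_cast
    refine Finset.sum_congr rfl fun j _ => ?_
    rw [Finset.mul_sum]
    refine Finset.sum_congr rfl fun n _ => ?_
    rw [← hE₁, ← hE₂, map_intCast, map_intCast]
    ring
  have hc0 : (c : ℝ) ≠ 0 := by exact_mod_cast hc'.ne'
  have hterm : ∀ j ∈ range c, (E₂ (j : ZMod q₂) : ℝ) * sawtooth ((j : ℝ) / c) *
        ∑ n ∈ range q₁, (E₁ (n : ZMod q₁) : ℝ) *
          sawtooth ((n : ℝ) / q₁ + ((a * j : ℤ) : ℝ) / (c : ℝ)) =
      (((j : ℤ) * E₂ (j : ZMod q₂) * g (a * j) : ℤ) : ℝ) / c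
        - ((E₂ (j : ZMod q₂) * g (a * j) : ℤ) : ℝ) / 2 := by
    intro j hj
    by_cases hmj : (m : ℤ) ∣ a * j
    · have h1 : (m : ℤ) ∣ j := hcop.dvd_of_dvd_mul_left hmj
      have h2 : q₂ ∣ j := (Dvd.intro_left t hm.symm).trans (by exact_mod_cast h1)
      rw [(ZMod.natCast_eq_zero_iff j q₂).2 h2, hzero₂]
      simp
    · have hjc : j < c := by simpa using hj
      have hj0 : 0 < j := by
        rcases Nat.eq_zero_or_pos j with rfl | h
        · simp at hmj
        · exact h
      have hlt : (j : ℝ) / c < 1 := by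
        rw [div_lt_one (by exact_mod_cast hc')]
        exact_mod_cast hjc
      have hpos : (0 : ℝ) < (j : ℝ) / c := by positivity
      have hsaw : sawtooth ((j : ℝ) / c) = (j : ℝ) / c - 1 / 2 := by
        rw [sawtooth, if_neg, Int.fract_eq_self.2 ⟨hpos.le, hlt⟩]
        rintro ⟨n, hn⟩
        rw [← hn] at hpos hlt
        have h1 : 0 < n := by exact_mod_cast hpos
        have h2 : n < 1 := by exact_mod_cast hlt
        omega
      rw [hg _ hmj, hsaw]
      push_cast
      ring
  rw [hS, Finset.sum_congr rfl hterm, Finset.sum_sub_distrib, ← Finset.sum_div, ← Finset.sum_div,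
    ← Int.cast_sum, ← Int.cast_sum, hM0, hz]
  push_cast
  have hc0' : (c : ℂ) ≠ 0 := by exact_mod_cast hc'.ne'
  field_simp
  ring

theorem newform_dedekind_sum_gamma0_denominator_gcd {q₁ q₂ : ℕ} (hq₁ : 0 < q₁) (hq₂ : 0 < q₂)
    (χ₁ : DirichletCharacter ℂ q₁) (χ₂ : DirichletCharacter ℂ q₂)
    (hχ₁ : χ₁ ≠ 1) (hχ₂ : χ₂ ≠ 1) (hp₁ : χ₁.IsPrimitive) (hp₂ : χ₂.IsPrimitive)
    (hpar : χ₁ (-1) * χ₂ (-1) = 1)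
    (hquad₁ : χ₁ ^ 2 = 1) (hquad₂ : χ₂ ^ 2 = 1)
    (hodd₁ : Odd q₁) (hodd₂ : Odd q₂) (h4₁ : 4 < q₁) (h4₂ : 4 < q₂) :
    ∀ γ : Matrix.SpecialLinearGroup (Fin 2) ℤ, InGamma0 (q₁ * q₂) γ →
      ∃ z : ℤ, (Nat.gcd q₁ q₂ : ℂ) * newformDedekindSumSL χ₁ χ₂ γ = (z : ℂ) := by
  intro γ hγ
  obtain ⟨E₁, hE₁⟩ := DirichletCharacter.exists_int_of_sq_eq_one χ₁ hquad₁
  obtain ⟨E₂, hE₂⟩ := DirichletCharacter.exists_int_of_sq_eq_one χ₂ hquad₂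
  have hB := DirichletCharacter.dvd_sum_mul_of_quadratic χ₁ hp₁ hodd₁ h4₁ E₁ hE₁ hquad₁
  have hdet : γ.1 0 0 * γ.1 1 1 - γ.1 0 1 * γ.1 1 0 = 1 := by
    rw [← Matrix.det_fin_two]
    exact γ.2
  have hint : ∃ z : ℤ, newformDedekindSumSL χ₁ χ₂ γ = z := by
    rw [newformDedekindSumSL]
    split_ifs with h0 h1
    · exact ⟨0, by simp⟩
    · exact newformDedekindSum_eq_int hq₁ hq₂ χ₁ χ₂ hχ₁ hχ₂ E₁ E₂ hE₁ hE₂ hB _ (γ.1 1 1) _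
        (by omega) hγ ⟨γ.1 0 1, by linear_combination hdet⟩
    · exact newformDedekindSum_eq_int hq₁ hq₂ χ₁ χ₂ hχ₁ hχ₂ E₁ E₂ hE₁ hE₂ hB _ (-(γ.1 1 1)) _
        (by omega) ((dvd_neg).2 hγ) ⟨-(γ.1 0 1), by linear_combination hdet⟩
  obtain ⟨z, hz⟩ := hint
  exact ⟨Nat.gcd q₁ q₂ * z, by rw [hz]; push_cast; rfl⟩
end

section
/- Suppose χ₁ and χ₂ are quadratic, q₁, q₂ > 4 are odd, and gcd(q₁,q₂) = 1. Then for every γ ∈ Γ₀(q₁q₂), S_{χ₁,χ₂}(γ) is a rational integer. -/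
open Complex Finset
open scoped Classical

theorem sum_range_eq_sum_zmod {M : Type*} [AddCommMonoid M] (c : ℕ) [NeZero c] (F : ℕ → M) :
    ∑ j ∈ Finset.range c, F j = ∑ x : ZMod c, F x.val := by
  refine Finset.sum_nbij' (fun j => (j : ZMod c)) ZMod.val (fun _ _ => Finset.mem_univ _)
    (fun x _ => Finset.mem_range.2 x.val_lt) ?_ (fun x _ => ZMod.natCast_zmod_val x) ?_
  · intro j hj
    exact ZMod.val_cast_of_lt (Finset.mem_range.1 hj)
  · intro j hj
    rw [ZMod.val_cast_of_lt (Finset.mem_range.1 hj)]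

/-- A character whose square is trivial lifts to an integer-valued character. -/
theorem exists_int_mulChar_of_sq_eq_one {q : ℕ} (χ : DirichletCharacter ℂ q) (h : χ ^ 2 = 1) :
    ∃ X : MulChar (ZMod q) ℤ, ∀ a, (X a : ℂ) = χ a := by
  have hval : ∀ a, ∃ z : ℤ, (z : ℂ) = χ a := by
    intro a
    by_cases ha : IsUnit a
    · have h1 : χ a ^ 2 = 1 := by
        rw [← MulChar.pow_apply' χ two_ne_zero, h, MulChar.one_apply ha]
      rcases mul_self_eq_one_iff.1 ((sq _).symm.trans h1) with h2 | h2
      · exact ⟨1, by simp [h2]⟩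
      · exact ⟨-1, by simp [h2]⟩
    · exact ⟨0, by simp [χ.map_nonunit ha]⟩
  choose f hf using hval
  refine ⟨{ toFun := f, map_one' := ?_, map_mul' := ?_, map_nonunit' := ?_ }, hf⟩
  · have := hf 1
    rw [map_one] at this
    exact_mod_cast this
  · intro x y
    have := hf (x * y)
    rw [map_mul, ← hf, ← hf] at this
    exact_mod_cast this
  · intro a ha
    have := hf a
    rw [χ.map_nonunit ha] at this
    exact_mod_cast this

theorem MulChar.int_sq_eq_one {q : ℕ} {X : MulChar (ZMod q) ℤ} {a : ZMod q} (ha : IsUnit a) :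
    X a = 1 ∨ X a = -1 :=
  Int.isUnit_iff.1 (ha.map X)

/-- The first moment of an integer-valued character is an eigenvector for the twisted action of
the units. -/
theorem MulChar.int_moment_twist {q : ℕ} [NeZero q] (X : MulChar (ZMod q) ℤ) (t : (ZMod q)ˣ) :
    ((∑ n ∈ Finset.range q, X n * n : ℤ) : ZMod q) =
      X t * t * ((∑ n ∈ Finset.range q, X n * n : ℤ) : ZMod q) := by
  have h : ((∑ n ∈ Finset.range q, X n * n : ℤ) : ZMod q) = ∑ x : ZMod q, (X x : ZMod q) * x := by
    rw [sum_range_eq_sum_zmod]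
    simp
  rw [h, Finset.mul_sum]
  conv_lhs => rw [← Equiv.sum_comp (Units.mulLeft t)]
  refine Finset.sum_congr rfl fun x _ => ?_
  simp only [Units.mulLeft_apply, map_mul]
  push_cast
  ring

/-- Integrality of the generalised Bernoulli number `B_{1,χ}` of a primitive quadratic character
of odd conductor `q > 4`. -/
theorem dvd_int_moment_of_isPrimitive {q : ℕ} (χ : DirichletCharacter ℂ q) (hp : χ.IsPrimitive)
    (hodd : Odd q) (h4 : 4 < q) (X : MulChar (ZMod q) ℤ) (hX : ∀ a, (X a : ℂ) = χ a) :
    (q : ℤ) ∣ ∑ n ∈ Finset.range q, X n * n := by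
  have : NeZero q := ⟨by omega⟩
  set A : ℤ := ∑ n ∈ Finset.range q, X n * n with hA
  have key : ∀ t : ℕ, t.Coprime q → (q : ℤ) ∣ (X t * t - 1) * A := by
    intro t ht
    have h := X.int_moment_twist (ZMod.unitOfCoprime t ht)
    rw [← hA, ZMod.coe_unitOfCoprime] at h
    rw [← ZMod.intCast_zmod_eq_zero_iff_dvd]
    push_cast
    rw [sub_mul, ← h]
    ring
  have hunit : ∀ t : ℕ, t.Coprime q → X t = 1 ∨ X t = -1 := fun t ht =>
    MulChar.int_sq_eq_one ((ZMod.isUnit_iff_coprime t q).2 ht)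
  have h2 : Nat.Coprime 2 q := hodd.coprime_two_left
  have h3A : (q : ℤ) ∣ 3 * A := by
    have h := key 2 h2
    rcases hunit 2 h2 with h' | h' <;> rw [h'] at h
    · norm_num at h
      exact h.mul_left 3
    · norm_num at h
      exact h
  by_cases h3 : 3 ∣ q
  · obtain ⟨r, rfl⟩ := h3
    have hr : (r : ℤ) ≠ 0 := by have := NeZero.ne (3 * r); simp at this; exact_mod_cast this
    push_cast at h3A
    obtain ⟨A', hA'⟩ := (mul_dvd_mul_iff_left (by norm_num : (3 : ℤ) ≠ 0)).1 h3A
    by_contra hnot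
    have h3A' : ¬ (3 : ℤ) ∣ A' := by
      rintro ⟨B, rfl⟩
      exact hnot ⟨B, by rw [hA']; push_cast; ring⟩
    have hmod : ∀ t : ℕ, t.Coprime (3 * r) → (3 : ℤ) ∣ X t * t - 1 := by
      intro t ht
      have h := key t ht
      rw [hA'] at h
      push_cast at h
      rw [show (X t * t - 1) * ((r : ℤ) * A') = ((X t * t - 1) * A') * r by ring] at h
      exact (Int.prime_three.dvd_or_dvd ((mul_dvd_mul_iff_right hr).1 h)).resolve_right h3A'
    have hfac : χ.FactorsThrough 3 := by
      rw [DirichletCharacter.factorsThrough_iff_ker_unitsMap (Dvd.intro r rfl)]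
      intro u hu
      have hcop := ZMod.val_coe_unit_coprime u
      have hu1 : ((u : ZMod (3 * r)).val : ZMod 3) = 1 := by
        have := congrArg Units.val (MonoidHom.mem_ker.1 hu)
        rw [ZMod.unitsMap_val] at this
        rw [← ZMod.cast_eq_val]
        simpa using this
      have hd := hmod _ hcop
      have hd' : (3 : ℤ) ∣ ((u : ZMod (3 * r)).val : ℤ) - 1 := by
        refine (ZMod.intCast_zmod_eq_zero_iff_dvd _ 3).1 ?_
        push_cast
        rw [hu1, sub_self]
      have hXu := hunit _ hcop
      rw [ZMod.natCast_zmod_val] at hd hXu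
      have hX1 : X u = 1 := by
        rcases hXu with h | h
        · exact h
        · rw [h] at hd
          omega
      rw [MonoidHom.mem_ker]
      ext
      rw [MulChar.coe_toUnitHom, ← hX, hX1]
      simp
    have hle := Nat.le_of_dvd three_pos
      (hp ▸ χ.conductor_dvd_of_mem_conductorSet hfac : (3 * r) ∣ 3)
    omega
  · have hc : IsCoprime (q : ℤ) 3 := by
      have := ((Nat.Prime.coprime_iff_not_dvd Nat.prime_three).2 h3).symm
      exact_mod_cast Nat.isCoprime_iff_coprime.2 this
    exact hc.dvd_of_dvd_mul_left h3A

theorem sawtooth_add_intCast (x : ℝ) (z : ℤ) : sawtooth (x + z) = sawtooth x := by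
  have : (∃ n : ℤ, (n : ℝ) = x + z) ↔ ∃ n : ℤ, (n : ℝ) = x :=
    ⟨fun ⟨n, hn⟩ => ⟨n - z, by push_cast; rw [hn]; ring⟩,
      fun ⟨n, hn⟩ => ⟨n + z, by push_cast; rw [hn]⟩⟩
  simp only [sawtooth, this, Int.fract_add_intCast]

theorem sawtooth_of_mem_Ioo {x : ℝ} (h0 : 0 < x) (h1 : x < 1) : sawtooth x = x - 1 / 2 := by
  have : ¬ ∃ n : ℤ, (n : ℝ) = x := by
    rintro ⟨n, rfl⟩
    have h0' : 0 < n := by exact_mod_cast h0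
    have h1' : n < 1 := by exact_mod_cast h1
    omega
  rw [sawtooth, if_neg this, Int.fract_eq_self.2 ⟨h0.le, h1⟩]

theorem MulChar.map_zero_of_ne_one {R R' : Type*} [CommRing R] [CommMonoidWithZero R']
    {X : MulChar R R'} (hX : X ≠ 1) : X 0 = 0 := by
  have : Nontrivial R := by
    by_contra hn
    rw [not_nontrivial_iff_subsingleton] at hn
    exact hX (MulChar.ext fun t => by rw [Subsingleton.elim (t : R) 1, map_one, map_one])
  exact X.map_zero

theorem MulChar.int_sum_range_eq_zero {q : ℕ} [NeZero q] {X : MulChar (ZMod q) ℤ} (hX : X ≠ 1) :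
    ∑ n ∈ Finset.range q, X n = 0 := by
  rw [sum_range_eq_sum_zmod]
  simpa using MulChar.sum_eq_zero_of_ne_one hX

/-- Summation over `range (a * b)` by Euclidean division by `b`. -/
theorem sum_range_mul_eq {M : Type*} [AddCommMonoid M] (a b : ℕ) (F : ℕ → M) :
    ∑ k ∈ Finset.range (a * b), F k =
      ∑ m ∈ Finset.range a, ∑ r ∈ Finset.range b, F (b * m + r) := by
  induction a with
  | zero => simp
  | succ a ih =>
    rw [Nat.succ_mul, Finset.sum_range_add, ih, Finset.sum_range_succ]
    simp only [mul_comm]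

theorem MulChar.int_sum_range_mul_eq_zero {q : ℕ} [NeZero q] {X : MulChar (ZMod q) ℤ}
    (hX : X ≠ 1) (e : ℕ) : ∑ n ∈ Finset.range (e * q), X n = 0 := by
  rw [sum_range_mul_eq]
  simp [MulChar.int_sum_range_eq_zero hX]

/-- The integer `∑ χ(n) {(m + n) / q}`. -/
def charStep {q : ℕ} (X : MulChar (ZMod q) ℤ) (m : ℕ) : ℤ :=
  (∑ n ∈ Finset.range q, X n * ((n + m) % q : ℕ)) / q

theorem mul_charStep {q : ℕ} {X : MulChar (ZMod q) ℤ} [NeZero q] (hX : X ≠ 1)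
    (hdvd : (q : ℤ) ∣ ∑ n ∈ Finset.range q, X n * n) (m : ℕ) :
    (q : ℤ) * charStep X m = ∑ n ∈ Finset.range q, X n * ((n + m) % q : ℕ) := by
  rw [charStep]
  refine Int.mul_ediv_cancel' ?_
  have h : ∑ n ∈ Finset.range q, X n * ((n + m) % q : ℕ) =
      ∑ n ∈ Finset.range q, X n * n + (∑ n ∈ Finset.range q, X n) * m -
        q * ∑ n ∈ Finset.range q, X n * ((n + m) / q : ℕ) := by
    rw [Finset.sum_mul, Finset.mul_sum, ← Finset.sum_add_distrib, ← Finset.sum_sub_distrib]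
    refine Finset.sum_congr rfl fun n _ => ?_
    have := Nat.mod_add_div (n + m) q
    have h' : (((n + m) % q : ℕ) : ℤ) = n + m - q * ((n + m) / q : ℕ) := by
      rw [eq_sub_iff_add_eq]
      exact_mod_cast this
    rw [h']
    ring
  rw [h, MulChar.int_sum_range_eq_zero hX]
  exact dvd_sub (by simpa using hdvd) (Dvd.intro _ rfl)

theorem sum_charStep {q : ℕ} {X : MulChar (ZMod q) ℤ} [NeZero q] (hX : X ≠ 1)
    (hdvd : (q : ℤ) ∣ ∑ n ∈ Finset.range q, X n * n) :
    ∑ m ∈ Finset.range q, charStep X m = 0 := by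
  have hq : (q : ℤ) ≠ 0 := by exact_mod_cast NeZero.ne q
  refine (mul_eq_zero.1 ?_).resolve_left hq
  rw [Finset.mul_sum, Finset.sum_congr rfl fun m _ => mul_charStep hX hdvd m, Finset.sum_comm]
  have hconst : ∀ n : ℕ, ∑ m ∈ Finset.range q, (((n + m) % q : ℕ) : ℤ) =
      ∑ x : ZMod q, (x.val : ℤ) := by
    intro n
    rw [sum_range_eq_sum_zmod, ← Equiv.sum_comp (Equiv.addLeft (n : ZMod q)) fun x => (x.val : ℤ)]
    refine Finset.sum_congr rfl fun x _ => ?_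
    rw [Equiv.coe_addLeft, ← ZMod.val_natCast]
    push_cast
    rw [ZMod.natCast_zmod_val]
  simp_rw [← Finset.mul_sum, hconst, ← Finset.sum_mul]
  rw [MulChar.int_sum_range_eq_zero hX, zero_mul]

/-- `∑ χ(n) B₁(n / q + x)` is an integer for `x = k / (q * M)` with `M ∤ k`. -/
theorem sum_mul_sawtooth_eq_charStep {q : ℕ} {X : MulChar (ZMod q) ℤ} [NeZero q] (hX : X ≠ 1)
    (hdvd : (q : ℤ) ∣ ∑ n ∈ Finset.range q, X n * n) {M k : ℕ} (hk : ¬ M ∣ k) (hM : 0 < M) :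
    ∑ n ∈ Finset.range q, (X n : ℝ) * sawtooth ((n : ℝ) / q + (k : ℝ) / (q * M)) =
      charStep X (k / M) := by
  have hq : (0 : ℝ) < q := by exact_mod_cast NeZero.pos q
  have hM' : (0 : ℝ) < M := by exact_mod_cast hM
  have hsaw : ∀ n : ℕ, sawtooth ((n : ℝ) / q + (k : ℝ) / (q * M)) =
      (((n + k / M) % q : ℕ) : ℝ) / q + (((k % M : ℕ) : ℝ) / (q * M) - 1 / 2) := by
    intro n
    have e1 : (k : ℝ) = (k % M : ℕ) + M * (k / M : ℕ) := by exact_mod_cast (Nat.mod_add_div k M).symm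
    have e2 : (n : ℝ) + (k / M : ℕ) = ((n + k / M) % q : ℕ) + q * ((n + k / M) / q : ℕ) := by
      exact_mod_cast (Nat.mod_add_div (n + k / M) q).symm
    have hr0 : (0 : ℝ) < (k % M : ℕ) := by
      exact_mod_cast Nat.pos_of_ne_zero fun h => hk (Nat.dvd_of_mod_eq_zero h)
    have hr1 : ((k % M : ℕ) : ℝ) < M := by exact_mod_cast Nat.mod_lt k hM
    have hs : (((n + k / M) % q : ℕ) : ℝ) + 1 ≤ q := by
      exact_mod_cast Nat.mod_lt (n + k / M) (NeZero.pos q)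
    have hs0 : (0 : ℝ) ≤ ((n + k / M) % q : ℕ) := Nat.cast_nonneg _
    generalize ((n + k / M) % q : ℕ) = s at *
    generalize ((n + k / M) / q : ℕ) = z at *
    generalize k / M = u at *
    generalize k % M = r at *
    have e : (n : ℝ) / q + (k : ℝ) / (q * M) = ((s : ℝ) / q + (r : ℝ) / (q * M)) + ((z : ℤ) : ℝ) := by
      have : (n : ℝ) = s + q * z - u := by linarith
      rw [e1, this]
      push_cast
      field_simp
      ring
    rw [e, sawtooth_add_intCast, sawtooth_of_mem_Ioo]
    · ring
    · positivity
    · rw [div_add_div _ _ hq.ne' (by positivity), div_lt_one (by positivity)]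
      nlinarith [mul_pos hq hM', mul_pos hq hq, mul_pos (mul_pos hq hq) hM',
        mul_le_mul_of_nonneg_right hs (mul_pos hq hM').le, mul_lt_mul_of_pos_left hr1 hq]
  have h0 : ∑ n ∈ Finset.range q, (X n : ℝ) = 0 := by
    exact_mod_cast MulChar.int_sum_range_eq_zero hX
  have h1 : (q : ℝ) * charStep X (k / M) =
      ∑ n ∈ Finset.range q, (X n : ℝ) * (((n + k / M) % q : ℕ) : ℝ) := by
    have h := congrArg (Int.cast : ℤ → ℝ) (mul_charStep hX hdvd (k / M))
    push_cast at h ⊢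
    exact h
  simp_rw [hsaw, mul_add, Finset.sum_add_distrib, ← Finset.sum_mul, h0, zero_mul, add_zero,
    mul_div_assoc', ← Finset.sum_div, ← h1]
  field_simp

/-- The integral kernel `χ₂(k) ∑ χ₁(n) B₁(n / q₁ + k / c)` with `c = q₁ * M`. -/
def charKernel {q₁ q₂ : ℕ} (X₁ : MulChar (ZMod q₁) ℤ) (X₂ : MulChar (ZMod q₂) ℤ) (M k : ℕ) : ℤ :=
  X₂ k * charStep X₁ (k / M)

theorem sum_affine_mul_charKernel {q₁ q₂ : ℕ} [NeZero q₁] [NeZero q₂] {X₁ : MulChar (ZMod q₁) ℤ}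
    {X₂ : MulChar (ZMod q₂) ℤ} (hX₁ : X₁ ≠ 1) (hX₂ : X₂ ≠ 1)
    (hdvd : (q₁ : ℤ) ∣ ∑ n ∈ Finset.range q₁, X₁ n * n) {M : ℕ} (hM : q₂ ∣ M) (u v : ℤ) :
    ∑ k ∈ Finset.range (q₁ * M), (u * k + v) * charKernel X₁ X₂ M k = 0 := by
  obtain ⟨e, rfl⟩ := hM
  have hX : ∑ r ∈ Finset.range (q₂ * e), X₂ r = 0 := by
    rw [mul_comm]
    exact MulChar.int_sum_range_mul_eq_zero hX₂ e
  rw [sum_range_mul_eq]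
  have h : ∀ m ∈ Finset.range q₁, ∑ r ∈ Finset.range (q₂ * e),
      (u * ((q₂ * e * m + r : ℕ) : ℤ) + v) * charKernel X₁ X₂ (q₂ * e) (q₂ * e * m + r) =
      charStep X₁ m * ∑ r ∈ Finset.range (q₂ * e), u * (r * X₂ r) := by
    intro m _
    have h' : ∀ r ∈ Finset.range (q₂ * e),
        (u * ((q₂ * e * m + r : ℕ) : ℤ) + v) * charKernel X₁ X₂ (q₂ * e) (q₂ * e * m + r) =
        charStep X₁ m * (u * (r * X₂ r)) + (u * (q₂ * e * m) + v) * charStep X₁ m * X₂ r := by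
      intro r hr
      have hr' := Finset.mem_range.1 hr
      have hdiv : (q₂ * e * m + r) / (q₂ * e) = m := by
        rw [Nat.mul_add_div (by omega), Nat.div_eq_of_lt hr', add_zero]
      rw [charKernel, hdiv]
      push_cast
      rw [ZMod.natCast_self]
      simp only [zero_mul, zero_add]
      ring
    rw [Finset.sum_congr rfl h', Finset.sum_add_distrib, ← Finset.mul_sum, ← Finset.mul_sum _ _
      ((u * (q₂ * e * m) + v) * charStep X₁ m), hX, mul_zero, add_zero]
  rw [Finset.sum_congr rfl h, ← Finset.sum_mul, sum_charStep hX₁ hdvd, zero_mul]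

theorem exists_int_eq_newformDedekindSum {q₁ q₂ : ℕ} [NeZero q₁] [NeZero q₂]
    {χ₁ : DirichletCharacter ℂ q₁} {χ₂ : DirichletCharacter ℂ q₂} {X₁ : MulChar (ZMod q₁) ℤ}
    {X₂ : MulChar (ZMod q₂) ℤ} (h₁ : ∀ a, (X₁ a : ℂ) = χ₁ a) (h₂ : ∀ a, (X₂ a : ℂ) = χ₂ a)
    (hX₁ : X₁ ≠ 1) (hX₂ : X₂ ≠ 1) (hdvd : (q₁ : ℤ) ∣ ∑ n ∈ Finset.range q₁, X₁ n * n)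
    {a d : ℤ} {M : ℕ} (hM : q₂ ∣ M) (hM0 : 0 < M) (had : ((q₁ * M : ℕ) : ℤ) ∣ a * d - 1) :
    ∃ z : ℤ, newformDedekindSum χ₁ χ₂ a (q₁ * M : ℕ) = (z : ℂ) := by
  set c := q₁ * M with hc
  have hc0 : 0 < c := Nat.mul_pos (NeZero.pos q₁) hM0
  have : NeZero c := ⟨hc0.ne'⟩
  have hcR : (0 : ℝ) < c := by exact_mod_cast hc0
  have hq₂c : q₂ ∣ c := hM.mul_left q₁
  have hadc : (a : ZMod c) * d = 1 := by
    have := (ZMod.intCast_zmod_eq_zero_iff_dvd _ c).2 had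
    push_cast at this
    exact sub_eq_zero.1 this
  have hadq : (a : ZMod q₂) * d = 1 := by
    have := (ZMod.intCast_zmod_eq_zero_iff_dvd _ q₂).2
      ((Int.natCast_dvd_natCast.2 hq₂c).trans had)
    push_cast at this
    exact sub_eq_zero.1 this
  let H : ZMod c → ℤ := fun x => charKernel X₁ X₂ M x.val
  let u : (ZMod c)ˣ := ⟨a, d, hadc, by rw [mul_comm, hadc]⟩
  have hH : ∀ v w : ℤ, ∑ x : ZMod c, (v * x.val + w) * H x = 0 := fun v w => by
    rw [← sum_affine_mul_charKernel hX₁ hX₂ hdvd hM v w, ← hc, sum_range_eq_sum_zmod]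
  have hterm : ∀ x : ZMod c, (X₂ (x.val : ZMod q₂) : ℝ) * ∑ n ∈ Finset.range q₁, (X₁ n : ℝ) *
      sawtooth ((n : ℝ) / q₁ + (a : ℝ) * (x.val : ℝ) / c) = X₂ d * H (u * x) := by
    intro x
    set k := ((u : ZMod c) * x).val with hk
    have hkmod : (c : ℤ) ∣ a * x.val - k := by
      rw [← ZMod.intCast_zmod_eq_zero_iff_dvd]
      push_cast
      rw [hk, ZMod.natCast_zmod_val, ZMod.natCast_zmod_val, sub_self]
    have hkq : (k : ZMod q₂) = a * (x.val : ZMod q₂) := by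
      have := (ZMod.intCast_zmod_eq_zero_iff_dvd _ q₂).2
        ((Int.natCast_dvd_natCast.2 hq₂c).trans hkmod)
      push_cast at this
      exact (sub_eq_zero.1 this).symm
    have hX : X₂ (x.val : ZMod q₂) = X₂ d * X₂ k := by
      rw [← map_mul, hkq, ← mul_assoc, mul_comm (d : ZMod q₂), hadq, one_mul]
    obtain ⟨z, hz⟩ := hkmod
    have hper : ∀ n : ℕ, sawtooth ((n : ℝ) / q₁ + (a : ℝ) * (x.val : ℝ) / c) =
        sawtooth ((n : ℝ) / q₁ + (k : ℝ) / (q₁ * M)) := by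
      intro n
      rw [← sawtooth_add_intCast ((n : ℝ) / q₁ + (k : ℝ) / (q₁ * M)) z]
      have hz' : (a : ℝ) * x.val - k = c * z := by exact_mod_cast hz
      have hcc : (q₁ : ℝ) * M = c := by rw [hc]; push_cast; rfl
      rw [hcc, eq_add_of_sub_eq hz']
      congr 1
      field_simp
      ring
    simp_rw [hper, hX]
    change _ = (X₂ d : ℝ) * ((X₂ k * charStep X₁ (k / M) : ℤ) : ℝ)
    by_cases hMk : M ∣ k
    · have : X₂ (k : ZMod q₂) = 0 := by
        rw [(ZMod.natCast_eq_zero_iff k q₂).2 (hM.trans hMk)]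
        exact MulChar.map_zero_of_ne_one hX₂
      simp [this]
    · rw [sum_mul_sawtooth_eq_charStep hX₁ hdvd hMk hM0]
      push_cast
      ring
  have hdvdc : (c : ℤ) ∣ ∑ x : ZMod c, x.val * H (u * x) := by
    rw [← ZMod.intCast_zmod_eq_zero_iff_dvd]
    have h := congrArg (Int.cast : ℤ → ZMod c) (hH 1 0)
    push_cast at h ⊢
    simp only [ZMod.natCast_zmod_val, one_mul, add_zero] at h ⊢
    rw [← Equiv.sum_comp (Units.mulLeft u⁻¹)]
    simp only [Units.mulLeft_apply, Units.mul_inv_cancel_left, mul_assoc, ← Finset.mul_sum, h,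
      mul_zero]
  have hzero : ∑ x : ZMod c, H (u * x) = 0 := by
    have := Equiv.sum_comp (Units.mulLeft u) H
    simp only [Units.mulLeft_apply] at this
    rw [this]
    simpa using hH 0 1
  obtain ⟨z, hz⟩ := hdvdc
  refine ⟨X₂ d * z, ?_⟩
  have hreal : ∑ j ∈ Finset.range c, ∑ n ∈ Finset.range q₁, (X₂ (j : ZMod q₂) : ℝ) * X₁ n *
      sawtooth ((j : ℝ) / c) * sawtooth ((n : ℝ) / q₁ + (a : ℝ) * (j : ℝ) / c) =
      (X₂ d * z : ℤ) := by
    rw [sum_range_eq_sum_zmod]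
    have hsum : ∀ x : ZMod c, ∑ n ∈ Finset.range q₁, (X₂ (x.val : ZMod q₂) : ℝ) * X₁ n *
        sawtooth ((x.val : ℝ) / c) * sawtooth ((n : ℝ) / q₁ + (a : ℝ) * (x.val : ℝ) / c) =
        X₂ d * ((x.val * H (u * x) : ℤ) / c - 1 / 2 * H (u * x)) := by
      intro x
      have e : ∑ n ∈ Finset.range q₁, (X₂ (x.val : ZMod q₂) : ℝ) * X₁ n *
          sawtooth ((x.val : ℝ) / c) * sawtooth ((n : ℝ) / q₁ + (a : ℝ) * (x.val : ℝ) / c) =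
          sawtooth ((x.val : ℝ) / c) * (X₂ d * H (u * x)) := by
        rw [← hterm, Finset.mul_sum, Finset.mul_sum]
        exact Finset.sum_congr rfl fun n _ => by ring
      rw [e]
      by_cases hx : x = 0
      · have : H (u * x) = 0 := by
          simp [H, hx, charKernel, MulChar.map_zero_of_ne_one hX₂]
        simp [this]
      · have hpos : (0 : ℝ) < x.val := by
          exact_mod_cast Nat.pos_of_ne_zero fun h => hx ((ZMod.val_eq_zero x).1 h)
        have hlt : (x.val : ℝ) < c := by exact_mod_cast x.val_lt
        rw [sawtooth_of_mem_Ioo (by positivity) ((div_lt_one hcR).2 hlt)]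
        push_cast
        ring
    rw [Finset.sum_congr rfl fun x _ => hsum x, ← Finset.mul_sum, Finset.sum_sub_distrib,
      ← Finset.mul_sum, ← Finset.sum_div, ← Int.cast_sum, ← Int.cast_sum, hz, hzero]
    push_cast
    field_simp
    ring
  have := congrArg (Complex.ofReal) hreal
  rw [newformDedekindSum, Int.toNat_natCast]
  push_cast at this
  push_cast
  rw [← this]
  simp only [← h₁, ← h₂, map_intCast]

theorem newform_dedekind_sum_gamma0_integer_of_coprime {q₁ q₂ : ℕ} (hq₁ : 0 < q₁) (hq₂ : 0 < q₂)
    (χ₁ : DirichletCharacter ℂ q₁) (χ₂ : DirichletCharacter ℂ q₂)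
    (hχ₁ : χ₁ ≠ 1) (hχ₂ : χ₂ ≠ 1) (hp₁ : χ₁.IsPrimitive) (hp₂ : χ₂.IsPrimitive)
    (hpar : χ₁ (-1) * χ₂ (-1) = 1)
    (hquad₁ : χ₁ ^ 2 = 1) (hquad₂ : χ₂ ^ 2 = 1)
    (hodd₁ : Odd q₁) (hodd₂ : Odd q₂) (h4₁ : 4 < q₁) (h4₂ : 4 < q₂)
    (hgcd : Nat.gcd q₁ q₂ = 1) :
    ∀ γ : Matrix.SpecialLinearGroup (Fin 2) ℤ, InGamma0 (q₁ * q₂) γ →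
      ∃ z : ℤ, newformDedekindSumSL χ₁ χ₂ γ = (z : ℂ) := by
  intro γ hγ
  have : NeZero q₁ := ⟨hq₁.ne'⟩
  have : NeZero q₂ := ⟨hq₂.ne'⟩
  obtain ⟨X₁, h₁⟩ := exists_int_mulChar_of_sq_eq_one χ₁ hquad₁
  obtain ⟨X₂, h₂⟩ := exists_int_mulChar_of_sq_eq_one χ₂ hquad₂
  have hX₁ : X₁ ≠ 1 := by
    rintro rfl
    exact hχ₁ (MulChar.ext fun t => by rw [← h₁]; simp)
  have hX₂ : X₂ ≠ 1 := by
    rintro rfl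
    exact hχ₂ (MulChar.ext fun t => by rw [← h₂]; simp)
  have hdvd := dvd_int_moment_of_isPrimitive χ₁ hp₁ hodd₁ h4₁ X₁ h₁
  have hint : ∀ a b c d : ℤ, a * d - b * c = 1 → 1 ≤ c → ((q₁ * q₂ : ℕ) : ℤ) ∣ c →
      ∃ z : ℤ, newformDedekindSum χ₁ χ₂ a c = (z : ℂ) := by
    intro a b c d hdet hc hN
    lift c to ℕ using by omega
    obtain ⟨e, rfl⟩ := Int.natCast_dvd_natCast.1 hN
    rw [mul_assoc] at hc hdet ⊢
    refine exists_int_eq_newformDedekindSum h₁ h₂ hX₁ hX₂ hdvd (d := d) (Dvd.intro e rfl) ?_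
      ⟨b, by linarith⟩
    refine Nat.pos_of_ne_zero fun h => ?_
    simp [h] at hc
  have hdet := γ.2
  rw [Matrix.det_fin_two] at hdet
  rw [newformDedekindSumSL]
  split_ifs with h0 h1
  · exact ⟨0, by simp⟩
  · exact hint _ _ _ _ hdet h1 hγ
  · exact hint _ (-(γ.1 0 1)) _ (-(γ.1 1 1)) (by linarith) (by omega) (hγ.neg_right)
end
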